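/- arXiv:1003.1156 — 2 statements merged into one kernel-verified Lean document; each statement's English description precedes it below -/
import Mathlib

section
/- Let γ be a smooth family of nondegenerate classical paths over an open set O ⊆ ℝ_{>0} × ℝ^n × ℝ^n with Hamilton function S_γ, and set L(t,q_0,q_1) = ½ log|det(∂²(−S_γ)/∂q_0∂q_1)(t,q_0,q_1)| (the matrix being invertible by nondegeneracy). Then on O: ∂L/∂t = Σ_j (∂(−S_γ)/∂q_1^j + B_j(q_1)) ∂L/∂q_1^j + ½ Σ_j ∂²(−S_γ)/∂(q_1^j)² + ½ Σ_j (∂B_j/∂q^j)(q_1). Equivalently, D := det(∂²(−S_γ)/∂q_0∂q_1) satisfies the continuity (Van Vleck transport) equation ∂D/∂t + Σ_j ∂/∂q_1^j (D · γ̇^j(t;t,q_0,q_1)) = 0, where γ̇(t;t,q_0,q_1) = (∂γ/∂τ)(t;t,q_0,q_1) is the terminal velocity of the family member. -/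
open MeasureTheory Set
open scoped BigOperators

noncomputable section

/-- Partial derivative of `f : ℝⁿ → ℝ` in the `j`-th coordinate direction. -/
def pd {n : ℕ} (f : (Fin n → ℝ) → ℝ) (j : Fin n) (q : Fin n → ℝ) : ℝ :=
  fderiv ℝ f q (Pi.single j 1)

/-- The classical equation of motion on the time interval `[0, t]`. -/
def IsClassical {n : ℕ} (B : Fin n → (Fin n → ℝ) → ℝ) (C : (Fin n → ℝ) → ℝ)
    (t : ℝ) (γ : ℝ → Fin n → ℝ) : Prop :=
  ∀ τ ∈ Icc (0:ℝ) t, ∀ i,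
    deriv (deriv γ) τ i
      + (∑ j, (pd (B i) j (γ τ) - pd (B j) i (γ τ)) * deriv γ τ j)
      + pd C i (γ τ) = 0

/-- The Jacobi operator `D_γ` (linearization of the equation of motion along `γ`). -/
def Jacobi {n : ℕ} (B : Fin n → (Fin n → ℝ) → ℝ) (C : (Fin n → ℝ) → ℝ)
    (γ ξ : ℝ → Fin n → ℝ) (τ : ℝ) (i : Fin n) : ℝ :=
  deriv (deriv ξ) τ i
    + (∑ j, (pd (B i) j (γ τ) - pd (B j) i (γ τ)) * deriv ξ τ j)
    + ∑ j, ((∑ k, pd (fun q => pd (B i) k q - pd (B k) i q) j (γ τ) * deriv γ τ k)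
        + pd (pd C i) j (γ τ)) * ξ τ j

/-- A classical path of duration `t` is nondegenerate if the only smooth based loop
annihilated by the Jacobi operator vanishes identically on `[0,t]`. -/
def Nondegenerate {n : ℕ} (B : Fin n → (Fin n → ℝ) → ℝ) (C : (Fin n → ℝ) → ℝ)
    (t : ℝ) (γ : ℝ → Fin n → ℝ) : Prop :=
  ∀ ξ : ℝ → Fin n → ℝ, ContDiff ℝ (⊤ : ℕ∞) ξ → ξ 0 = 0 → ξ t = 0 →
    (∀ τ ∈ Icc (0:ℝ) t, ∀ i, Jacobi B C γ ξ τ i = 0) →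
    ∀ τ ∈ Icc (0:ℝ) t, ξ τ = 0

/-- The action of a path of duration `t`. -/
def action {n : ℕ} (B : Fin n → (Fin n → ℝ) → ℝ) (C : (Fin n → ℝ) → ℝ)
    (t : ℝ) (γ : ℝ → Fin n → ℝ) : ℝ :=
  ∫ τ in (0:ℝ)..t,
    ((1:ℝ)/2 * ∑ i, deriv γ τ i ^ 2 + ∑ i, B i (γ τ) * deriv γ τ i - C (γ τ))

/-- A smooth family of nondegenerate classical paths with boundary values
`(t, q₀, q₁)` ranging over an open set `O ⊆ ℝ_{>0} × ℝⁿ × ℝⁿ`. -/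
structure SmoothFamily {n : ℕ} (B : Fin n → (Fin n → ℝ) → ℝ) (C : (Fin n → ℝ) → ℝ)
    (O : Set (ℝ × (Fin n → ℝ) × (Fin n → ℝ))) where
  f : ℝ → ℝ → (Fin n → ℝ) → (Fin n → ℝ) → Fin n → ℝ
  isOpen : IsOpen O
  pos : ∀ p ∈ O, 0 < p.1
  smooth : ContDiffOn ℝ (⊤ : ℕ∞)
      (fun p : ℝ × ℝ × (Fin n → ℝ) × (Fin n → ℝ) => f p.1 p.2.1 p.2.2.1 p.2.2.2)
      {p : ℝ × ℝ × (Fin n → ℝ) × (Fin n → ℝ) | p.2 ∈ O ∧ p.1 ∈ Icc 0 p.2.1}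
  pathSmooth : ∀ p ∈ O, ContDiff ℝ (⊤ : ℕ∞) fun τ => f τ p.1 p.2.1 p.2.2
  isClassical : ∀ p ∈ O, IsClassical B C p.1 fun τ => f τ p.1 p.2.1 p.2.2
  nondeg : ∀ p ∈ O, Nondegenerate B C p.1 fun τ => f τ p.1 p.2.1 p.2.2
  bdry0 : ∀ p ∈ O, f 0 p.1 p.2.1 p.2.2 = p.2.1
  bdry1 : ∀ p ∈ O, f p.1 p.1 p.2.1 p.2.2 = p.2.2

/-- The Hamilton function of a smooth family of classical paths. -/
def famS {n : ℕ} {B : Fin n → (Fin n → ℝ) → ℝ} {C : (Fin n → ℝ) → ℝ}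
    {O : Set (ℝ × (Fin n → ℝ) × (Fin n → ℝ))} (F : SmoothFamily B C O)
    (t : ℝ) (q0 q1 : Fin n → ℝ) : ℝ :=
  action B C t fun τ => F.f τ t q0 q1

/-- The mixed Hessian `(l, m) ↦ ∂²S/∂q₀^l∂q₁^m`. -/
def Hess01 {n : ℕ} (S : ℝ → (Fin n → ℝ) → (Fin n → ℝ) → ℝ)
    (t : ℝ) (q0 q1 : Fin n → ℝ) : Matrix (Fin n) (Fin n) ℝ :=
  Matrix.of fun l m =>
    fderiv ℝ (fun q0' => fderiv ℝ (fun q1' => S t q0' q1') q1 (Pi.single m 1)) q0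
      (Pi.single l 1)

/-- Heaviside's step function, with `Θ 0 = 1/2`. -/
def Heav (x : ℝ) : ℝ := if x < 0 then 0 else if x = 0 then 1/2 else 1

/-- The Green's kernel `G_γ` of a smooth family of nondegenerate classical paths. -/
def Green {n : ℕ} {B : Fin n → (Fin n → ℝ) → ℝ} {C : (Fin n → ℝ) → ℝ}
    {O : Set (ℝ × (Fin n → ℝ) × (Fin n → ℝ))} (F : SmoothFamily B C O)
    (t : ℝ) (q0 q1 : Fin n → ℝ) (ς τ : ℝ) (i j : Fin n) : ℝ :=
  Heav (ς - τ) * ∑ k, ∑ l,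
      fderiv ℝ (fun q => F.f ς t q q1 i) q0 (Pi.single k 1)
        * ((Hess01 (fun a b c => -(famS F a b c)) t q0 q1).transpose)⁻¹ k l
        * fderiv ℝ (fun q => F.f τ t q0 q j) q1 (Pi.single l 1)
  + Heav (τ - ς) * ∑ k, ∑ l,
      fderiv ℝ (fun q => F.f ς t q0 q i) q1 (Pi.single k 1)
        * (Hess01 (fun a b c => -(famS F a b c)) t q0 q1)⁻¹ k l
        * fderiv ℝ (fun q => F.f τ t q q1 j) q0 (Pi.single l 1)

/-- The Hessian of the action at a path `γ` of duration `t`, as a bilinear form. -/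
def hess {n : ℕ} (B : Fin n → (Fin n → ℝ) → ℝ) (C : (Fin n → ℝ) → ℝ)
    (t : ℝ) (γ ξ ζ : ℝ → Fin n → ℝ) : ℝ :=
  ∫ τ in (0:ℝ)..t,
    ((∑ i, deriv ξ τ i * deriv ζ τ i)
      + (∑ i, ∑ j, pd (B i) j (γ τ) * (deriv ξ τ i * ζ τ j + deriv ζ τ i * ξ τ j))
      + ∑ j, ∑ k,
          ((∑ i, pd (pd (B i) j) k (γ τ) * deriv γ τ i) - pd (pd C j) k (γ τ))
            * (ξ τ j * ζ τ k))

/-- The Jacobi fields `∂γ/∂q_a^j` of a smooth family (`a = 0` or `a = 1`). -/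
def jfield {n : ℕ} {B : Fin n → (Fin n → ℝ) → ℝ} {C : (Fin n → ℝ) → ℝ}
    {O : Set (ℝ × (Fin n → ℝ) × (Fin n → ℝ))} (F : SmoothFamily B C O)
    (t : ℝ) (q0 q1 : Fin n → ℝ) (a : Fin 2) (j : Fin n) : ℝ → Fin n → ℝ :=
  fun τ i =>
    if a = 0 then fderiv ℝ (fun q => F.f τ t q q1 i) q0 (Pi.single j 1)
    else fderiv ℝ (fun q => F.f τ t q0 q i) q1 (Pi.single j 1)

/-- Partial derivative of a function of `(t, q₀, q₁)` in the direction `q_a^j`. -/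
def pdS {n : ℕ} (S : ℝ → (Fin n → ℝ) → (Fin n → ℝ) → ℝ) (a : Fin 2) (j : Fin n)
    (t : ℝ) (q0 q1 : Fin n → ℝ) : ℝ :=
  if a = 0 then fderiv ℝ (fun q => S t q q1) q0 (Pi.single j 1)
  else fderiv ℝ (fun q => S t q0 q) q1 (Pi.single j 1)

theorem vv_det_fderiv {n : ℕ} {E : Type*} [NormedAddCommGroup E] [NormedSpace ℝ E]
    (H : E → Matrix (Fin n) (Fin n) ℝ) (H' : Fin n → Fin n → E →L[ℝ] ℝ) (x : E)
    (h : ∀ i j, HasFDerivAt (fun y => H y i j) (H' i j) x) :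
    HasFDerivAt (fun y => (H y).det)
      (∑ i, ∑ k, (H x).adjugate k i • H' i k) x := by
  let D : ContinuousMultilinearMap ℝ (fun _ : Fin n => Fin n → ℝ) ℝ :=
    { (Matrix.detRowAlternating (R := ℝ) (n := Fin n)).toMultilinearMap with
      cont := by
        change Continuous fun M : Fin n → Fin n → ℝ => Matrix.det (Matrix.of M)
        exact Continuous.matrix_det (by fun_prop) }
  have h1 : HasFDerivAt (fun y => (fun i => H y i : Fin n → Fin n → ℝ))
      (ContinuousLinearMap.pi fun i => ContinuousLinearMap.pi fun j => H' i j) x := by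
    rw [hasFDerivAt_pi]
    intro i
    rw [hasFDerivAt_pi]
    intro j
    exact h i j
  have h2 := (D.hasFDerivAt (fun i => H x i)).comp x h1
  refine h2.congr_fderiv ?_
  ext v
  simp only [ContinuousLinearMap.comp_apply, ContinuousMultilinearMap.linearDeriv_apply,
    sum_apply, smul_apply, smul_eq_mul]
  refine Finset.sum_congr rfl fun i _ => ?_
  change ((H x).updateRow i (fun k => H' i k v)).det = _
  have : (fun k => H' i k v) = ∑ k, H' i k v • (Pi.single k (1:ℝ) : Fin n → ℝ) := by
    ext k; simp [Finset.sum_apply, Pi.single_apply]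
  have key := map_sum (D.toMultilinearMap.toLinearMap (fun i => H x i) i)
    (fun k => H' i k v • (Pi.single k (1:ℝ) : Fin n → ℝ)) Finset.univ
  rw [← this] at key
  refine (key.trans ?_)
  refine Finset.sum_congr rfl fun k _ => ?_
  rw [LinearMap.map_smul, smul_eq_mul, mul_comm]
  congr 1
  rw [Matrix.adjugate_apply]
  rfl

theorem vv_integral_fderiv {E : Type*} [NormedAddCommGroup E] [NormedSpace ℝ E]
    [FiniteDimensional ℝ E] (O : Set E) (hO : IsOpen O) (L : ℝ × E → ℝ)
    (hL : ContDiffOn ℝ (⊤ : ℕ∞) L (Icc (0:ℝ) 1 ×ˢ O)) (p : E) (hp : p ∈ O) (v : E → ℝ)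
    (hv : ∀ δ, ∫ s in (0:ℝ)..1, fderivWithin ℝ L (Icc (0:ℝ) 1 ×ˢ O) (s, p) (0, δ) = v δ) :
    ∃ v' : E →L[ℝ] ℝ, (∀ δ, v' δ = v δ) ∧
      HasFDerivAt (fun p => ∫ s in (0:ℝ)..1, L (s, p)) v' p := by
  have hprop : ProperSpace E := FiniteDimensional.proper_real E
  set K := Icc (0:ℝ) 1 ×ˢ O with hK
  have hU : UniqueDiffOn ℝ K := (uniqueDiffOn_Icc zero_lt_one).prod hO.uniqueDiffOn
  have hd : ContinuousOn (fderivWithin ℝ L K) K := hL.continuousOn_fderivWithin hU (by simp)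
  let F' : E → ℝ → E →L[ℝ] ℝ := fun q s =>
    (fderivWithin ℝ L K (s, q)).comp (ContinuousLinearMap.inr ℝ ℝ E)
  obtain ⟨r, hr, hball⟩ := Metric.nhds_basis_closedBall.mem_iff.1 (hO.mem_nhds hp)
  have hcont : ∀ q ∈ O, ContinuousOn (fun s => F' q s) (Icc 0 1) := by
    intro q hq
    have : ContinuousOn (fun s : ℝ => fderivWithin ℝ L K (s, q)) (Icc 0 1) :=
      hd.comp (by fun_prop) (fun s hs => ⟨hs, hq⟩)
    exact this.clm_comp continuousOn_const
  have hcont0 : ∀ q ∈ O, ContinuousOn (fun s => L (s, q)) (Icc 0 1) := fun q hq =>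
    hL.continuousOn.comp (by fun_prop) (fun s hs => ⟨hs, hq⟩)
  obtain ⟨M, hM⟩ := (isCompact_Icc.prod (isCompact_closedBall p r)).exists_bound_of_continuousOn
    (f := fun x : ℝ × E => F' x.2 x.1) (s := Icc (0:ℝ) 1 ×ˢ Metric.closedBall p r) (by
      have : ContinuousOn (fun x : ℝ × E => fderivWithin ℝ L K x)
        (Icc (0:ℝ) 1 ×ˢ Metric.closedBall p r) := hd.mono (prod_mono le_rfl hball)
      exact this.clm_comp continuousOn_const)
  have hI : uIoc (0:ℝ) 1 ⊆ Icc 0 1 := by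
    rw [uIoc_of_le zero_le_one]; exact Ioc_subset_Icc_self
  have key := intervalIntegral.hasFDerivAt_integral_of_dominated_of_fderiv_le
    (𝕜 := ℝ) (μ := volume) (a := 0) (b := 1)
    (F := fun q s => L (s, q)) (F' := F') (x₀ := p) (s := Metric.ball p r) (bound := fun _ => M)
    (Metric.ball_mem_nhds p hr) ?_ ?_ ?_ ?_ ?_ ?_
  · refine ⟨_, fun δ => ?_, key⟩
    rw [ContinuousLinearMap.intervalIntegral_apply, ← hv]
    · rfl
    · refine ContinuousOn.intervalIntegrable ?_
      rw [uIcc_of_le zero_le_one]; exact hcont p hp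
  · filter_upwards [hO.mem_nhds hp] with q hq
    exact ((hcont0 q hq).mono hI).aestronglyMeasurable measurableSet_uIoc
  · refine ContinuousOn.intervalIntegrable ?_
    rw [uIcc_of_le zero_le_one]; exact hcont0 p hp
  · exact ((hcont p hp).mono hI).aestronglyMeasurable measurableSet_uIoc
  · exact Filter.Eventually.of_forall fun s hs q hq =>
      hM (s, q) ⟨hI hs, Metric.ball_subset_closedBall hq⟩
  · exact intervalIntegrable_const
  · refine Filter.Eventually.of_forall fun s hs q hq => ?_
    have hqO := hball (Metric.ball_subset_closedBall hq)
    have h1 : HasFDerivWithinAt L (fderivWithin ℝ L K (s, q)) K (s, q) :=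
      (hL.differentiableOn (by simp) _ ⟨hI hs, hqO⟩).hasFDerivWithinAt
    have h2 : HasFDerivWithinAt (fun q : E => (s, q)) (ContinuousLinearMap.inr ℝ ℝ E) O q :=
      (hasFDerivAt_prodMk_right s q).hasFDerivWithinAt
    exact (h1.comp q h2 (fun q' hq' => ⟨hI hs, hq'⟩)).hasFDerivAt (hO.mem_nhds hqO)

theorem vv_transport {n : ℕ} (O : Set (ℝ × (Fin n → ℝ) × (Fin n → ℝ))) (hO : IsOpen O)
    (B : Fin n → (Fin n → ℝ) → ℝ) (C : (Fin n → ℝ) → ℝ)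
    (hB : ∀ i, ContDiff ℝ (⊤ : ℕ∞) (B i)) (hC : ContDiff ℝ (⊤ : ℕ∞) C)
    (U : (ℝ × (Fin n → ℝ) × (Fin n → ℝ)) → Fin n → ℝ) (hU : ContDiffOn ℝ (⊤ : ℕ∞) U O)
    (S : (ℝ × (Fin n → ℝ) × (Fin n → ℝ)) → ℝ)
    (Φ : (ℝ × (Fin n → ℝ) × (Fin n → ℝ)) → (ℝ × (Fin n → ℝ) × (Fin n → ℝ)) →L[ℝ] ℝ)
    (hS : ∀ p ∈ O, HasFDerivAt S (Φ p) p) (hΦ : ∀ p ∈ O, DifferentiableAt ℝ Φ p)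
    (hΦ1 : ∀ p ∈ O, ∀ m, Φ p (0, 0, Pi.single m 1) = U p m + B m p.2.2)
    (hΦ0 : ∀ p ∈ O, Φ p (1, 0, 0) = -((1:ℝ)/2 * ∑ i, U p i ^ 2 + C p.2.2))
    (D : (ℝ × (Fin n → ℝ) × (Fin n → ℝ)) → ℝ)
    (hD : ∀ p ∈ O, D p =
      (Matrix.of fun l m => -(fderiv ℝ U p (0, Pi.single l 1, 0) m) :
        Matrix (Fin n) (Fin n) ℝ).det)
    (p : ℝ × (Fin n → ℝ) × (Fin n → ℝ)) (hp : p ∈ O) :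
    DifferentiableAt ℝ D p ∧
    fderiv ℝ D p (1, 0, 0) + ∑ j, U p j * fderiv ℝ D p (0, 0, Pi.single j 1)
      = -(D p * ∑ j, fderiv ℝ U p (0, 0, Pi.single j 1) j) := by
  have hnh : ∀ p ∈ O, O ∈ nhds p := fun p hp => hO.mem_nhds hp
  have hUd : ∀ p ∈ O, DifferentiableAt ℝ U p := fun p hp =>
    ((hU p hp).contDiffAt (hnh p hp)).differentiableAt (by simp)
  have hUi : ∀ p ∈ O, ∀ i, HasFDerivAt (fun q => U q i)
      ((ContinuousLinearMap.proj i).comp (fderiv ℝ U p)) p := fun p hp i =>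
    hasFDerivAt_pi'.1 (hUd p hp).hasFDerivAt i
  have hBd : ∀ i q, DifferentiableAt ℝ (B i) q := fun i q =>
    (hB i).contDiffAt.differentiableAt (by simp)
  have hCd : ∀ q, DifferentiableAt ℝ C q := fun q => hC.contDiffAt.differentiableAt (by simp)
  have hsnd : ∀ p : ℝ × (Fin n → ℝ) × (Fin n → ℝ), HasFDerivAt
      (fun q : ℝ × (Fin n → ℝ) × (Fin n → ℝ) => q.2.2)
      ((ContinuousLinearMap.snd ℝ (Fin n → ℝ) (Fin n → ℝ)).comp
        (ContinuousLinearMap.snd ℝ ℝ ((Fin n → ℝ) × (Fin n → ℝ)))) p := fun p =>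
    (hasFDerivAt_snd).comp p hasFDerivAt_snd
  have hBp : ∀ i p, HasFDerivAt (fun q : ℝ × (Fin n → ℝ) × (Fin n → ℝ) => B i q.2.2)
      ((fderiv ℝ (B i) p.2.2).comp ((ContinuousLinearMap.snd ℝ (Fin n → ℝ) (Fin n → ℝ)).comp
        (ContinuousLinearMap.snd ℝ ℝ ((Fin n → ℝ) × (Fin n → ℝ))))) p := fun i p =>
    (hBd i p.2.2).hasFDerivAt.comp p (hsnd p)
  have hCp : ∀ p, HasFDerivAt (fun q : ℝ × (Fin n → ℝ) × (Fin n → ℝ) => C q.2.2)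
      ((fderiv ℝ C p.2.2).comp ((ContinuousLinearMap.snd ℝ (Fin n → ℝ) (Fin n → ℝ)).comp
        (ContinuousLinearMap.snd ℝ ℝ ((Fin n → ℝ) × (Fin n → ℝ))))) p := fun p =>
    (hCd p.2.2).hasFDerivAt.comp p (hsnd p)
  -- symmetry of the second derivative of S
  have hsym : ∀ p ∈ O, ∀ v w, fderiv ℝ Φ p v w = fderiv ℝ Φ p w v := fun p hp v w =>
    second_derivative_symmetric_of_eventually
      (by filter_upwards [hnh p hp] with y hy using hS y hy) (hΦ p hp).hasFDerivAt v w
  have hΦa : ∀ p ∈ O, ∀ w, HasFDerivAt (fun q => Φ q w)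
      ((fderiv ℝ Φ p).flip w) p := fun p hp w => by
    refine ((hΦ p hp).hasFDerivAt.clm_apply (hasFDerivAt_const w p)).congr_fderiv ?_
    ext <;> simp
  have h1 : ∀ p ∈ O, ∀ m v, fderiv ℝ Φ p v (0, 0, Pi.single m 1)
      = fderiv ℝ U p v m + fderiv ℝ (B m) p.2.2 v.2.2 := by
    intro p hp m v
    have e := (hΦa p hp (0, 0, Pi.single m 1)).unique
      (((hUi p hp m).add (hBp m p)).congr_of_eventuallyEq
        (by filter_upwards [hnh p hp] with y hy using hΦ1 y hy m))
    have := congrArg (fun T => T v) e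
    simpa using this
  have h0 : ∀ p ∈ O, ∀ v, fderiv ℝ Φ p v (1, 0, 0)
      = -((∑ i, U p i * fderiv ℝ U p v i) + fderiv ℝ C p.2.2 v.2.2) := by
    intro p hp v
    have e := (hΦa p hp (1, 0, 0)).unique
      ((((HasFDerivAt.fun_sum (u := Finset.univ) fun i _ => (hUi p hp i).pow 2).const_mul
        ((1:ℝ)/2)).add (hCp p)).neg.congr_of_eventuallyEq
        (by filter_upwards [hnh p hp] with y hy using hΦ0 y hy))
    have := congrArg (fun T => T v) e
    simp [Finset.mul_sum] at this
    rw [this]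
    simp only [neg_add]
    rw [add_comm]
    congr 2
    refine Finset.sum_congr rfl fun i _ => ?_
    ring
  have hii : ∀ p ∈ O, ∀ m j, fderiv ℝ U p (0, 0, Pi.single m 1) j
      + fderiv ℝ (B j) p.2.2 (Pi.single m 1) = fderiv ℝ U p (0, 0, Pi.single j 1) m
      + fderiv ℝ (B m) p.2.2 (Pi.single j 1) := by
    intro p hp m j
    rw [← h1 p hp j (0, 0, Pi.single m 1), ← h1 p hp m (0, 0, Pi.single j 1)]
    exact hsym p hp _ _
  have hi : ∀ p ∈ O, ∀ m, fderiv ℝ U p (1, 0, 0) m =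
      -((∑ i, U p i * fderiv ℝ U p (0, 0, Pi.single m 1) i)
        + fderiv ℝ C p.2.2 (Pi.single m 1)) := by
    intro p hp m
    have := h1 p hp m (1, 0, 0)
    rw [hsym p hp, h0 p hp] at this
    simpa using this.symm
  -- second derivatives of U
  have hU' : ContDiffOn ℝ (⊤ : ℕ∞) (fderiv ℝ U) O := hU.fderiv_of_isOpen hO (by simp)
  have hU'd : HasFDerivAt (fderiv ℝ U) (fderiv ℝ (fderiv ℝ U) p) p :=
    (((hU' p hp).contDiffAt (hnh p hp)).differentiableAt (by simp)).hasFDerivAt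
  set T := fderiv ℝ (fderiv ℝ U) p with hT
  have hTs : ∀ v w, T v w = T w v := fun v w =>
    second_derivative_symmetric_of_eventually
      (by filter_upwards [hnh p hp] with y hy using (hUd y hy).hasFDerivAt) hU'd v w
  have hTa : ∀ w i, HasFDerivAt (fun q => fderiv ℝ U q w i)
      ((ContinuousLinearMap.proj i).comp (T.flip w)) p := fun w i => by
    refine (hasFDerivAt_pi'.1 (hU'd.clm_apply (hasFDerivAt_const w p)) i).congr_fderiv ?_
    ext <;> simp
  have hiv : ∀ l m j, T (0, Pi.single l 1, 0) (0, 0, Pi.single m 1) j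
      = T (0, Pi.single l 1, 0) (0, 0, Pi.single j 1) m := by
    intro l m j
    have hfd : ∀ i k, HasFDerivAt (fun q : ℝ × (Fin n → ℝ) × (Fin n → ℝ) =>
        fderiv ℝ (B i) q.2.2 (Pi.single k 1)) ((fderiv ℝ (fun q => fderiv ℝ (B i) q
          (Pi.single k 1)) p.2.2).comp ((ContinuousLinearMap.snd ℝ (Fin n → ℝ) (Fin n → ℝ)).comp
        (ContinuousLinearMap.snd ℝ ℝ ((Fin n → ℝ) × (Fin n → ℝ))))) p := by
      intro i k
      have : DifferentiableAt ℝ (fun q => fderiv ℝ (B i) q (Pi.single k 1)) p.2.2 := by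
        have : ContDiff ℝ (⊤ : ℕ∞) (fun q => fderiv ℝ (B i) q (Pi.single k 1)) :=
          ((hB i).fderiv_right (by simp)).clm_apply contDiff_const
        exact this.contDiffAt.differentiableAt (by simp)
      exact HasFDerivAt.comp p this.hasFDerivAt (hsnd p)
    have e := ((hTa (0, 0, Pi.single m 1) j).add (hfd j m)).unique
      (((hTa (0, 0, Pi.single j 1) m).add (hfd m j)).congr_of_eventuallyEq
        (by filter_upwards [hnh p hp] with y hy using hii y hy m j))
    have := congrArg (fun T => T (0, Pi.single l 1, 0)) e
    simpa using this
  have hiii : ∀ l m, T (0, Pi.single l 1, 0) (1, 0, 0) m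
      = -∑ j, (U p j * T (0, Pi.single l 1, 0) (0, 0, Pi.single m 1) j
        + fderiv ℝ U p (0, Pi.single l 1, 0) j * fderiv ℝ U p (0, 0, Pi.single m 1) j) := by
    intro l m
    have hfd : HasFDerivAt (fun q : ℝ × (Fin n → ℝ) × (Fin n → ℝ) =>
        fderiv ℝ C q.2.2 (Pi.single m 1)) ((fderiv ℝ (fun q => fderiv ℝ C q
          (Pi.single m 1)) p.2.2).comp ((ContinuousLinearMap.snd ℝ (Fin n → ℝ) (Fin n → ℝ)).comp
        (ContinuousLinearMap.snd ℝ ℝ ((Fin n → ℝ) × (Fin n → ℝ))))) p := by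
      have : DifferentiableAt ℝ (fun q => fderiv ℝ C q (Pi.single m 1)) p.2.2 := by
        have : ContDiff ℝ (⊤ : ℕ∞) (fun q => fderiv ℝ C q (Pi.single m 1)) :=
          (hC.fderiv_right (by simp)).clm_apply contDiff_const
        exact this.contDiffAt.differentiableAt (by simp)
      exact HasFDerivAt.comp p this.hasFDerivAt (hsnd p)
    have e := (hTa (1, 0, 0) m).unique
      (((HasFDerivAt.fun_sum (u := Finset.univ) fun j _ => (hUi p hp j).mul
        (hTa (0, 0, Pi.single m 1) j)).add hfd).neg.congr_of_eventuallyEq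
        (by filter_upwards [hnh p hp] with y hy using hi y hy m))
    have := congrArg (fun T => T (0, Pi.single l 1, 0)) e
    simp at this
    rw [this]
    congr 1
    refine Finset.sum_congr rfl fun i _ => ?_
    ring
  -- derivative of the determinant
  let H : (ℝ × (Fin n → ℝ) × (Fin n → ℝ)) → Matrix (Fin n) (Fin n) ℝ := fun q =>
    Matrix.of fun l m => -(fderiv ℝ U q (0, Pi.single l 1, 0) m)
  have hdet := vv_det_fderiv H
    (fun l m => -((ContinuousLinearMap.proj m).comp (T.flip (0, Pi.single l 1, 0)))) p
    (fun l m => (hTa (0, Pi.single l 1, 0) m).neg)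
  have hDd := hdet.congr_of_eventuallyEq (f₁ := D)
    (by filter_upwards [hnh p hp] with y hy using hD y hy)
  refine ⟨hDd.differentiableAt, ?_⟩
  let N : Matrix (Fin n) (Fin n) ℝ := Matrix.of fun j m => -fderiv ℝ U p (0, 0, Pi.single m 1) j
  have hDv : ∀ v, fderiv ℝ D p v = ∑ l, ∑ m, (H p).adjugate m l * (-T v (0, Pi.single l 1, 0) m) := by
    intro v
    rw [hDd.fderiv]
    simp
  have hsum : fderiv ℝ D p (1, 0, 0) + ∑ j, U p j * fderiv ℝ D p (0, 0, Pi.single j 1)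
      = ∑ l, ∑ m, (H p).adjugate m l * (H p * N) l m := by
    have hent : ∀ l m, (H p * N) l m = -T (1, 0, 0) (0, Pi.single l 1, 0) m
        + ∑ j, U p j * (-T (0, 0, Pi.single j 1) (0, Pi.single l 1, 0) m) := by
      intro l m
      rw [Matrix.mul_apply, hTs, hiii, neg_neg, ← Finset.sum_add_distrib]
      refine Finset.sum_congr rfl fun j _ => ?_
      rw [hTs (0, 0, Pi.single j 1), hiv l m j]
      simp [H, N]
    simp only [hDv, hent, mul_add, Finset.sum_add_distrib]
    congr 1
    simp only [Finset.mul_sum]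
    rw [Finset.sum_comm]
    refine Finset.sum_congr rfl fun l _ => ?_
    rw [Finset.sum_comm]
    refine Finset.sum_congr rfl fun m _ => Finset.sum_congr rfl fun j _ => ?_
    ring
  rw [hsum, hD p hp]
  change _ = -((H p).det * _)
  have htr : ∑ l, ∑ m, (H p).adjugate m l * (H p * N) l m
      = ((H p).adjugate * (H p * N)).trace := by
    simp only [Matrix.trace, Matrix.diag, Matrix.mul_apply (M := (H p).adjugate)]
    rw [Finset.sum_comm]
  rw [htr, ← Matrix.mul_assoc, Matrix.adjugate_mul, Matrix.smul_mul, Matrix.one_mul,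
    Matrix.trace_smul]
  simp [Matrix.trace, N]

section VVFamily

variable {n : ℕ} {B : Fin n → (Fin n → ℝ) → ℝ} {C : (Fin n → ℝ) → ℝ}
    {O : Set (ℝ × (Fin n → ℝ) × (Fin n → ℝ))}

/-- The family in the rescaled time `s = τ / t`. -/
def vvG (F : SmoothFamily B C O) (x : ℝ × ℝ × (Fin n → ℝ) × (Fin n → ℝ)) : Fin n → ℝ :=
  F.f (x.1 * x.2.1) x.2.1 x.2.2.1 x.2.2.2

/-- The rescaled velocity. -/
def vvV (F : SmoothFamily B C O) (x : ℝ × ℝ × (Fin n → ℝ) × (Fin n → ℝ)) : Fin n → ℝ :=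
  fderivWithin ℝ (vvG F) (Icc (0:ℝ) 1 ×ˢ O) x (1, 0)

/-- The rescaled Lagrangian. -/
def vvL (F : SmoothFamily B C O) (x : ℝ × ℝ × (Fin n → ℝ) × (Fin n → ℝ)) : ℝ :=
  (1:ℝ)/2 * (x.2.1)⁻¹ * (∑ i, vvV F x i ^ 2) + (∑ i, B i (vvG F x) * vvV F x i)
    - x.2.1 * C (vvG F x)

/-- The terminal velocity. -/
def vvU (F : SmoothFamily B C O) (p : ℝ × (Fin n → ℝ) × (Fin n → ℝ)) : Fin n → ℝ :=
  deriv (fun τ => F.f τ p.1 p.2.1 p.2.2) p.1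

theorem vvK_unique (F : SmoothFamily B C O) : UniqueDiffOn ℝ (Icc (0:ℝ) 1 ×ˢ O) :=
  (uniqueDiffOn_Icc zero_lt_one).prod F.isOpen.uniqueDiffOn

theorem vvG_smooth (F : SmoothFamily B C O) :
    ContDiffOn ℝ (⊤ : ℕ∞) (vvG F) (Icc (0:ℝ) 1 ×ˢ O) := by
  have h : ContDiff ℝ (⊤ : ℕ∞) (fun x : ℝ × ℝ × (Fin n → ℝ) × (Fin n → ℝ) =>
      ((x.1 * x.2.1, x.2) : ℝ × ℝ × (Fin n → ℝ) × (Fin n → ℝ))) := by fun_prop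
  refine F.smooth.comp h.contDiffOn ?_
  rintro ⟨s, p⟩ ⟨hs, hp⟩
  have := F.pos p hp
  refine ⟨hp, ?_, ?_⟩
  · exact mul_nonneg hs.1 this.le
  · exact mul_le_of_le_one_left this.le hs.2

theorem vvV_smooth (F : SmoothFamily B C O) :
    ContDiffOn ℝ (⊤ : ℕ∞) (vvV F) (Icc (0:ℝ) 1 ×ˢ O) :=
  ((vvG_smooth F).fderivWithin (vvK_unique F) (by simp)).clm_apply contDiffOn_const

theorem vvG_deriv (F : SmoothFamily B C O) {p : ℝ × (Fin n → ℝ) × (Fin n → ℝ)} (hp : p ∈ O)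
    (s : ℝ) : HasDerivAt (fun s => vvG F (s, p))
      (p.1 • deriv (fun τ => F.f τ p.1 p.2.1 p.2.2) (s * p.1)) s := by
  have h1 : HasDerivAt (fun τ => F.f τ p.1 p.2.1 p.2.2)
      (deriv (fun τ => F.f τ p.1 p.2.1 p.2.2) (s * p.1)) (s * p.1) :=
    ((F.pathSmooth p hp).contDiffAt.differentiableAt (by simp)).hasDerivAt
  have h2 : HasDerivAt (fun s => s * p.1) p.1 s := by simpa using (hasDerivAt_id s).mul_const p.1
  exact h1.scomp s h2

theorem vvV_eq (F : SmoothFamily B C O) {p : ℝ × (Fin n → ℝ) × (Fin n → ℝ)} (hp : p ∈ O)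
    {s : ℝ} (hs : s ∈ Icc (0:ℝ) 1) :
    vvV F (s, p) = p.1 • deriv (fun τ => F.f τ p.1 p.2.1 p.2.2) (s * p.1) := by
  have h1 : HasFDerivWithinAt (vvG F) (fderivWithin ℝ (vvG F) (Icc (0:ℝ) 1 ×ˢ O) (s, p))
      (Icc (0:ℝ) 1 ×ˢ O) (s, p) :=
    ((vvG_smooth F).differentiableOn (by simp) _ ⟨hs, hp⟩).hasFDerivWithinAt
  have h2 : HasDerivWithinAt (fun s : ℝ => (s, p)) (1, 0) (Icc (0:ℝ) 1) s :=
    ((hasDerivAt_id s).prodMk (hasDerivAt_const s p)).hasDerivWithinAt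
  have h3 := h1.comp_hasDerivWithinAt s h2
    (show MapsTo (fun s : ℝ => (s, p)) (Icc (0:ℝ) 1) (Icc (0:ℝ) 1 ×ˢ O) from
      fun s' hs' => ⟨hs', hp⟩)
  exact (uniqueDiffOn_Icc zero_lt_one s hs).eq_deriv _ h3 (vvG_deriv F hp s).hasDerivWithinAt

theorem vvV_deriv (F : SmoothFamily B C O) {p : ℝ × (Fin n → ℝ) × (Fin n → ℝ)} (hp : p ∈ O)
    {s : ℝ} (hs : s ∈ Ioo (0:ℝ) 1) : HasDerivAt (fun s => vvV F (s, p))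
      (p.1 • p.1 • deriv (deriv (fun τ => F.f τ p.1 p.2.1 p.2.2)) (s * p.1)) s := by
  have h0 : ContDiff ℝ (⊤ : ℕ∞) (deriv (fun τ => F.f τ p.1 p.2.1 p.2.2)) :=
    ((contDiff_infty_iff_deriv).1 (F.pathSmooth p hp)).2
  have h1 : HasDerivAt (deriv (fun τ => F.f τ p.1 p.2.1 p.2.2))
      (deriv (deriv (fun τ => F.f τ p.1 p.2.1 p.2.2)) (s * p.1)) (s * p.1) :=
    (h0.contDiffAt.differentiableAt (by simp)).hasDerivAt
  have h2 : HasDerivAt (fun s => s * p.1) p.1 s := by simpa using (hasDerivAt_id s).mul_const p.1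
  refine ((h1.scomp s h2).const_smul p.1).congr_of_eventuallyEq ?_
  filter_upwards [Icc_mem_nhds hs.1 hs.2] with s' hs'
  exact vvV_eq F hp hs'

theorem vvU_eq (F : SmoothFamily B C O) {p : ℝ × (Fin n → ℝ) × (Fin n → ℝ)} (hp : p ∈ O) :
    vvU F p = (p.1)⁻¹ • vvV F (1, p) := by
  rw [vvV_eq F hp (by simp), smul_smul, inv_mul_cancel₀ (F.pos p hp).ne', one_smul, one_mul]
  rfl

theorem vvVs_smooth (F : SmoothFamily B C O) {s : ℝ} (hs : s ∈ Icc (0:ℝ) 1) :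
    ContDiffOn ℝ (⊤ : ℕ∞) (fun p => (p.1)⁻¹ • vvV F (s, p)) O := by
  have h1 : ContDiffOn ℝ (⊤ : ℕ∞) (fun p : ℝ × (Fin n → ℝ) × (Fin n → ℝ) => (p.1)⁻¹) O :=
    contDiff_fst.contDiffOn.inv (fun p hp => (F.pos p hp).ne')
  have h2 : ContDiffOn ℝ (⊤ : ℕ∞)
      (fun p : ℝ × (Fin n → ℝ) × (Fin n → ℝ) => vvV F (s, p)) O :=
    (vvV_smooth F).comp (by fun_prop) (fun p hp => ⟨hs, hp⟩)
  exact h1.smul h2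

theorem vvU_smooth (F : SmoothFamily B C O) : ContDiffOn ℝ (⊤ : ℕ∞) (vvU F) O :=
  (vvVs_smooth F (s := 1) (by simp)).congr fun _ hp => vvU_eq F hp

theorem vvL_smooth (hB : ∀ i, ContDiff ℝ (⊤ : ℕ∞) (B i)) (hC : ContDiff ℝ (⊤ : ℕ∞) C)
    (F : SmoothFamily B C O) :
    ContDiffOn ℝ (⊤ : ℕ∞) (vvL F) (Icc (0:ℝ) 1 ×ˢ O) := by
  have hV : ∀ i, ContDiffOn ℝ (⊤ : ℕ∞) (fun x => vvV F x i) (Icc (0:ℝ) 1 ×ˢ O) :=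
    fun i => contDiffOn_pi.1 (vvV_smooth F) i
  have ht : ContDiffOn ℝ (⊤ : ℕ∞)
    (fun x : ℝ × ℝ × (Fin n → ℝ) × (Fin n → ℝ) => x.2.1) (Icc (0:ℝ) 1 ×ˢ O) := by fun_prop
  refine ContDiffOn.sub (ContDiffOn.add ?_ ?_) ?_
  · refine ContDiffOn.mul (contDiffOn_const.mul (ht.inv fun x hx => (F.pos _ hx.2).ne')) ?_
    exact ContDiffOn.sum fun i _ => (hV i).pow 2
  · exact ContDiffOn.sum fun i _ => ((hB i).comp_contDiffOn (vvG_smooth F)).mul (hV i)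
  · exact ht.mul (hC.comp_contDiffOn (vvG_smooth F))

theorem vvS_eq (F : SmoothFamily B C O) {p : ℝ × (Fin n → ℝ) × (Fin n → ℝ)} (hp : p ∈ O) :
    famS F p.1 p.2.1 p.2.2 = ∫ s in (0:ℝ)..1, vvL F (s, p) := by
  have ht := F.pos p hp
  unfold famS action
  have := intervalIntegral.smul_integral_comp_mul_right (a := 0) (b := 1) (fun τ =>
    ((1:ℝ)/2 * ∑ i, deriv (fun τ => F.f τ p.1 p.2.1 p.2.2) τ i ^ 2
      + ∑ i, B i (F.f τ p.1 p.2.1 p.2.2) * deriv (fun τ => F.f τ p.1 p.2.1 p.2.2) τ i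
      - C (F.f τ p.1 p.2.1 p.2.2))) p.1
  rw [zero_mul, one_mul] at this
  rw [← this, ← intervalIntegral.integral_smul]
  refine intervalIntegral.integral_congr fun s hs => ?_
  rw [uIcc_of_le zero_le_one] at hs
  simp only [vvL, vvV_eq F hp hs, vvG, Pi.smul_apply, smul_eq_mul, mul_pow, ← Finset.mul_sum]
  rw [mul_sub, mul_add]
  congr 2
  · field_simp
  · rw [Finset.mul_sum]
    refine Finset.sum_congr rfl fun i _ => ?_
    ring

theorem vvG_one (F : SmoothFamily B C O) {p : ℝ × (Fin n → ℝ) × (Fin n → ℝ)} (hp : p ∈ O) :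
    vvG F (1, p) = p.2.2 := by
  simpa [vvG] using F.bdry1 p hp

theorem vvG_zero (F : SmoothFamily B C O) {p : ℝ × (Fin n → ℝ) × (Fin n → ℝ)} (hp : p ∈ O) :
    vvG F (0, p) = p.2.1 := by
  simpa [vvG] using F.bdry0 p hp

theorem vvG_fderiv_snd (F : SmoothFamily B C O) {p : ℝ × (Fin n → ℝ) × (Fin n → ℝ)}
    (hp : p ∈ O) {s : ℝ} (hs : s ∈ Icc (0:ℝ) 1) :
    HasFDerivAt (fun q => vvG F (s, q))
      ((fderivWithin ℝ (vvG F) (Icc (0:ℝ) 1 ×ˢ O) (s, p)).comp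
        (ContinuousLinearMap.inr ℝ ℝ (ℝ × (Fin n → ℝ) × (Fin n → ℝ)))) p := by
  have h1 : HasFDerivWithinAt (vvG F) (fderivWithin ℝ (vvG F) (Icc (0:ℝ) 1 ×ˢ O) (s, p))
      (Icc (0:ℝ) 1 ×ˢ O) (s, p) :=
    ((vvG_smooth F).differentiableOn (by simp) _ ⟨hs, hp⟩).hasFDerivWithinAt
  have h2 : HasFDerivWithinAt (fun q : ℝ × (Fin n → ℝ) × (Fin n → ℝ) => (s, q))
      (ContinuousLinearMap.inr ℝ ℝ _) O p := (hasFDerivAt_prodMk_right s p).hasFDerivWithinAt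
  exact (h1.comp p h2 (fun q' hq' => ⟨hs, hq'⟩)).hasFDerivAt (F.isOpen.mem_nhds hp)

theorem vvEta_one (F : SmoothFamily B C O) {p : ℝ × (Fin n → ℝ) × (Fin n → ℝ)}
    (hp : p ∈ O) (δ : ℝ × (Fin n → ℝ) × (Fin n → ℝ)) :
    fderivWithin ℝ (vvG F) (Icc (0:ℝ) 1 ×ˢ O) (1, p) (0, δ) = δ.2.2 := by
  have h1 := vvG_fderiv_snd F hp (s := 1) (by simp)
  have h2 : HasFDerivAt (fun q : ℝ × (Fin n → ℝ) × (Fin n → ℝ) => q.2.2)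
      ((ContinuousLinearMap.snd ℝ (Fin n → ℝ) (Fin n → ℝ)).comp
        (ContinuousLinearMap.snd ℝ ℝ ((Fin n → ℝ) × (Fin n → ℝ)))) p :=
    (hasFDerivAt_snd).comp p hasFDerivAt_snd
  have e := h1.unique (h2.congr_of_eventuallyEq
    (by filter_upwards [F.isOpen.mem_nhds hp] with q hq using vvG_one F hq))
  exact congrArg (fun T => T δ) e

theorem vvEta_zero (F : SmoothFamily B C O) {p : ℝ × (Fin n → ℝ) × (Fin n → ℝ)}
    (hp : p ∈ O) (δ : ℝ × (Fin n → ℝ) × (Fin n → ℝ)) :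
    fderivWithin ℝ (vvG F) (Icc (0:ℝ) 1 ×ˢ O) (0, p) (0, δ) = δ.2.1 := by
  have h1 := vvG_fderiv_snd F hp (s := 0) (by simp)
  have h2 : HasFDerivAt (fun q : ℝ × (Fin n → ℝ) × (Fin n → ℝ) => q.2.1)
      ((ContinuousLinearMap.fst ℝ (Fin n → ℝ) (Fin n → ℝ)).comp
        (ContinuousLinearMap.snd ℝ ℝ ((Fin n → ℝ) × (Fin n → ℝ)))) p :=
    (hasFDerivAt_fst).comp p hasFDerivAt_snd
  have e := h1.unique (h2.congr_of_eventuallyEq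
    (by filter_upwards [F.isOpen.mem_nhds hp] with q hq using vvG_zero F hq))
  exact congrArg (fun T => T δ) e

theorem vv_fderiv_sum (f : (Fin n → ℝ) → ℝ) (q w : Fin n → ℝ) :
    fderiv ℝ f q w = ∑ j, pd f j q * w j := by
  have : w = ∑ k, w k • (Pi.single k (1:ℝ) : Fin n → ℝ) := by
    ext k; simp [Finset.sum_apply, Pi.single_apply]
  conv_lhs => rw [this]
  rw [map_sum]
  refine Finset.sum_congr rfl fun k _ => ?_
  rw [map_smul, smul_eq_mul, mul_comm]
  rfl

theorem vv_algebra (b : Fin n → Fin n → ℝ) (c B V η ζ a : Fin n → ℝ) (t δ s c0 : ℝ) (ht : t ≠ 0)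
    (ha : ∀ i, a i = -(t * ∑ j, (b i j - b j i) * V j) - t ^ 2 * c i) :
    (∑ i, ((t⁻¹ * a i + ∑ j, b i j * V j) * η i + (t⁻¹ * V i + B i) * ζ i))
      - δ * (((1:ℝ)/2 * (t⁻¹) ^ 2 * ∑ i, V i ^ 2) + c0)
      - δ * s * ((1:ℝ)/2 * (t⁻¹) ^ 2 * (∑ i, 2 * V i * a i) + ∑ i, c i * V i)
    = -(δ * ((1:ℝ)/2 * (t⁻¹) ^ 2 * ∑ i, V i ^ 2))
      + (1:ℝ)/2 * t⁻¹ * (∑ i, 2 * V i * ζ i)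
      + (∑ i, (B i * ζ i + (∑ j, b i j * η j) * V i)) - (δ * c0 + t * ∑ i, c i * η i) := by
  have e1 : (1:ℝ)/2 * (t⁻¹) ^ 2 * (∑ i, 2 * V i * a i) + ∑ i, c i * V i = 0 := by
    have hz : ∑ i, ∑ j, (b i j - b j i) * V j * V i = 0 := by
      have : ∑ i, ∑ j, (b i j - b j i) * V j * V i = -∑ i, ∑ j, (b i j - b j i) * V j * V i := by
        conv_lhs => rw [Finset.sum_comm]
        rw [← Finset.sum_neg_distrib]
        refine Finset.sum_congr rfl fun i _ => ?_
        rw [← Finset.sum_neg_distrib]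
        refine Finset.sum_congr rfl fun j _ => ?_
        ring
      linarith
    have : ∀ i, 2 * V i * a i = -2 * t * (∑ j, (b i j - b j i) * V j * V i)
        - 2 * t ^ 2 * (c i * V i) := by
      intro i
      rw [ha, ← Finset.sum_mul]; ring
    simp only [this]
    rw [Finset.sum_sub_distrib, ← Finset.mul_sum, ← Finset.mul_sum, hz]
    field_simp
    ring
  have e2 : ∑ i, (t⁻¹ * a i + ∑ j, b i j * V j) * η i
      = ∑ i, (∑ j, b i j * η j) * V i - t * ∑ i, c i * η i := by
    have : ∀ i, (t⁻¹ * a i + ∑ j, b i j * V j) * η i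
        = ∑ j, b j i * V j * η i - t * (c i * η i) := by
      intro i
      rw [ha, ← Finset.sum_mul]
      have : ∑ j, (b i j - b j i) * V j = ∑ j, b i j * V j - ∑ j, b j i * V j := by
        rw [← Finset.sum_sub_distrib]
        exact Finset.sum_congr rfl fun j _ => by ring
      rw [this]
      field_simp
      ring
    simp only [this]
    rw [Finset.sum_sub_distrib, ← Finset.mul_sum, Finset.sum_comm]
    congr 1
    refine Finset.sum_congr rfl fun i _ => ?_
    rw [Finset.sum_mul]
    exact Finset.sum_congr rfl fun j _ => by ring
  have e3 : ∑ i, 2 * V i * ζ i = 2 * ∑ i, V i * ζ i := by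
    rw [Finset.mul_sum]; exact Finset.sum_congr rfl fun j _ => by ring
  have e4 : ∑ i, (t⁻¹ * V i + B i) * ζ i = t⁻¹ * ∑ i, V i * ζ i + ∑ i, B i * ζ i := by
    rw [Finset.mul_sum, ← Finset.sum_add_distrib]
    exact Finset.sum_congr rfl fun j _ => by ring
  rw [e1, Finset.sum_add_distrib, Finset.sum_add_distrib, e2, e3, e4]
  ring

theorem vv_EL (hB : ∀ i, ContDiff ℝ (⊤ : ℕ∞) (B i)) (hC : ContDiff ℝ (⊤ : ℕ∞) C)
    (F : SmoothFamily B C O) {p : ℝ × (Fin n → ℝ) × (Fin n → ℝ)}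
    (hp : p ∈ O) (δ : ℝ × (Fin n → ℝ) × (Fin n → ℝ)) {s : ℝ} (hs : s ∈ Ioo (0:ℝ) 1) :
    HasDerivAt (fun s => (∑ i, ((p.1)⁻¹ * vvV F (s, p) i + B i (vvG F (s, p)))
        * fderivWithin ℝ (vvG F) (Icc (0:ℝ) 1 ×ˢ O) (s, p) (0, δ) i)
      - δ.1 * s * ((1:ℝ)/2 * ((p.1)⁻¹) ^ 2 * (∑ i, vvV F (s, p) i ^ 2) + C (vvG F (s, p))))
      (fderivWithin ℝ (vvL F) (Icc (0:ℝ) 1 ×ˢ O) (s, p) (0, δ)) s := by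
  have ht := F.pos p hp
  set K := Icc (0:ℝ) 1 ×ˢ O with hK
  have hsI : s ∈ Icc (0:ℝ) 1 := Ioo_subset_Icc_self hs
  have hKn : K ∈ nhds (s, p) := prod_mem_nhds (Icc_mem_nhds hs.1 hs.2) (F.isOpen.mem_nhds hp)
  have hmem : (s, p) ∈ K := ⟨hsI, hp⟩
  have hG' : ContDiffOn ℝ (⊤ : ℕ∞) (fderivWithin ℝ (vvG F) K) K :=
    (vvG_smooth F).fderivWithin (vvK_unique F) (by simp)
  have hGd : HasFDerivAt (fderivWithin ℝ (vvG F) K)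
      (fderiv ℝ (fderivWithin ℝ (vvG F) K) (s, p)) (s, p) :=
    (((hG' _ hmem).contDiffAt hKn).differentiableAt (by simp)).hasFDerivAt
  set T := fderiv ℝ (fderivWithin ℝ (vvG F) K) (s, p) with hT
  have hGx : ∀ y ∈ interior K, HasFDerivAt (vvG F) (fderivWithin ℝ (vvG F) K y) y := by
    intro y hy
    exact ((vvG_smooth F).differentiableOn (by simp) y
      (interior_subset hy)).hasFDerivWithinAt.hasFDerivAt (mem_interior_iff_mem_nhds.1 hy)
  have hTs : ∀ v w, T v w = T w v := fun v w =>
    second_derivative_symmetric_of_eventually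
      (by filter_upwards [interior_mem_nhds.2 hKn] with y hy using hGx y hy) hGd v w
  have hG0 : HasFDerivAt (vvG F) (fderivWithin ℝ (vvG F) K (s, p)) (s, p) :=
    hGx _ (mem_interior_iff_mem_nhds.2 hKn)
  have hTa : ∀ w i, HasFDerivAt (fun y => fderivWithin ℝ (vvG F) K y w i)
      ((ContinuousLinearMap.proj i).comp (T.flip w)) (s, p) := fun w i => by
    refine (hasFDerivAt_pi'.1 (hGd.clm_apply (hasFDerivAt_const w (s, p))) i).congr_fderiv ?_
    ext <;> simp
  have hVf : ∀ i, HasFDerivAt (fun y => vvV F y i)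
      ((ContinuousLinearMap.proj i).comp (T.flip (1, 0))) (s, p) := fun i => hTa (1, 0) i
  have hline : HasDerivAt (fun s : ℝ => (s, p)) (1, 0) s :=
    (hasDerivAt_id s).prodMk (hasDerivAt_const s p)
  have hVs : ∀ i, HasDerivAt (fun s => vvV F (s, p) i) (T (1, 0) (1, 0) i) s := fun i => by
    have h := (hVf i).comp_hasDerivAt s hline
    exact h
  have hηs : ∀ i, HasDerivAt (fun s => fderivWithin ℝ (vvG F) K (s, p) (0, δ) i)
      (T (0, δ) (1, 0) i) s := fun i => by
    rw [hTs]
    exact (hTa (0, δ) i).comp_hasDerivAt s hline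
  have hGs : HasDerivAt (fun s => vvG F (s, p)) (vvV F (s, p)) s := by
    have h := hG0.comp_hasDerivAt s hline
    exact h
  have hBf : ∀ i, HasFDerivAt (B i) (fderiv ℝ (B i) (vvG F (s, p))) (vvG F (s, p)) := fun i =>
    ((hB i).contDiffAt.differentiableAt (by simp)).hasFDerivAt
  have hCf : HasFDerivAt C (fderiv ℝ C (vvG F (s, p))) (vvG F (s, p)) :=
    (hC.contDiffAt.differentiableAt (by simp)).hasFDerivAt
  -- equation of motion
  have heom : ∀ i, T (1, 0) (1, 0) i = -(p.1 * ∑ j, (pd (B i) j (vvG F (s, p))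
      - pd (B j) i (vvG F (s, p))) * vvV F (s, p) j) - p.1 ^ 2 * pd C i (vvG F (s, p)) := by
    intro i
    have h1 := (hVs i).unique (hasDerivAt_pi.1 (vvV_deriv F hp hs) i)
    have h2 := F.isClassical p hp (s * p.1)
      ⟨mul_nonneg hs.1.le ht.le, mul_le_of_le_one_left ht.le hs.2.le⟩ i
    rw [h1, vvV_eq F hp hsI]
    simp only [Pi.smul_apply, smul_eq_mul, vvG]
    have h3 : ∀ x : Fin n → ℝ, ∀ d : Fin n → ℝ,
        ∑ j, x j * (p.1 * d j) = p.1 * ∑ j, x j * d j := by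
      intro x d
      rw [Finset.mul_sum]; exact Finset.sum_congr rfl fun j _ => by ring
    rw [h3 (fun j => pd (B i) j (F.f (s * p.1) p.1 p.2.1 p.2.2)
      - pd (B j) i (F.f (s * p.1) p.1 p.2.1 p.2.2))]
    linear_combination p.1 ^ 2 * h2
  have hQ := (HasDerivAt.fun_sum (u := Finset.univ) fun i _ =>
      (((hVs i).const_mul ((p.1)⁻¹)).add ((hBf i).comp_hasDerivAt s hGs)).mul (hηs i)).sub
    (((hasDerivAt_id s).const_mul δ.1).mul
      (((HasDerivAt.fun_sum (u := Finset.univ) fun i _ => (hVs i).pow 2).const_mul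
        ((1:ℝ)/2 * ((p.1)⁻¹) ^ 2)).add (hCf.comp_hasDerivAt s hGs)))
  refine hQ.congr_deriv ?_
  -- the derivative of the Lagrangian
  have htf : HasFDerivAt (fun y : ℝ × ℝ × (Fin n → ℝ) × (Fin n → ℝ) => y.2.1)
      ((ContinuousLinearMap.fst ℝ ℝ ((Fin n → ℝ) × (Fin n → ℝ))).comp
        (ContinuousLinearMap.snd ℝ ℝ (ℝ × (Fin n → ℝ) × (Fin n → ℝ)))) (s, p) :=
    (hasFDerivAt_fst).comp (s, p) hasFDerivAt_snd
  have htinv : HasFDerivAt (fun y : ℝ × ℝ × (Fin n → ℝ) × (Fin n → ℝ) => (y.2.1)⁻¹)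
      ((-(p.1 ^ 2)⁻¹) • ((ContinuousLinearMap.fst ℝ ℝ ((Fin n → ℝ) × (Fin n → ℝ))).comp
        (ContinuousLinearMap.snd ℝ ℝ (ℝ × (Fin n → ℝ) × (Fin n → ℝ))))) (s, p) :=
    (hasDerivAt_inv ht.ne').comp_hasFDerivAt (s, p) htf
  have hLf : HasFDerivAt (vvL F) _ (s, p) :=
    (((htinv.const_mul ((1:ℝ)/2)).mul
      (HasFDerivAt.fun_sum (u := Finset.univ) fun i _ => (hVf i).pow 2)).add
      (HasFDerivAt.fun_sum (u := Finset.univ) fun i _ =>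
        ((hBf i).comp (s, p) hG0).mul (hVf i))).sub
      (htf.mul (hCf.comp (s, p) hG0))
  rw [fderivWithin_of_mem_nhds (f := vvL F) hKn, hLf.fderiv]
  have key := vv_algebra (fun i j => pd (B i) j (vvG F (s, p)))
    (fun i => pd C i (vvG F (s, p))) (fun i => B i (vvG F (s, p))) (vvV F (s, p))
    (fderivWithin ℝ (vvG F) K (s, p) (0, δ)) (T (0, δ) (1, 0)) (T (1, 0) (1, 0))
    p.1 δ.1 s (C (vvG F (s, p))) ht.ne' heom
  simp only [← vv_fderiv_sum] at key
  refine Eq.trans ?_ (key.trans ?_)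
  · simp [-one_div]
    ring
  · simp [-one_div]
    simp only [mul_assoc, mul_comm, mul_left_comm]
    ring

/-- The differential of the Hamilton function. -/
def vvPhi (F : SmoothFamily B C O) (p : ℝ × (Fin n → ℝ) × (Fin n → ℝ)) :
    (ℝ × (Fin n → ℝ) × (Fin n → ℝ)) →L[ℝ] ℝ :=
  (∑ i, (vvU F p i + B i p.2.2) •
      ((ContinuousLinearMap.proj (R := ℝ) (φ := fun _ : Fin n => ℝ) i).comp
      ((ContinuousLinearMap.snd ℝ (Fin n → ℝ) (Fin n → ℝ)).comp
        (ContinuousLinearMap.snd ℝ ℝ ((Fin n → ℝ) × (Fin n → ℝ))))))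
  - (∑ i, (((p.1)⁻¹ • vvV F (0, p)) i + B i p.2.1) •
      ((ContinuousLinearMap.proj (R := ℝ) (φ := fun _ : Fin n => ℝ) i).comp
      ((ContinuousLinearMap.fst ℝ (Fin n → ℝ) (Fin n → ℝ)).comp
        (ContinuousLinearMap.snd ℝ ℝ ((Fin n → ℝ) × (Fin n → ℝ))))))
  - ((1:ℝ)/2 * (∑ i, vvU F p i ^ 2) + C p.2.2) •
      (ContinuousLinearMap.fst ℝ ℝ ((Fin n → ℝ) × (Fin n → ℝ)))

theorem vvPhi_apply (F : SmoothFamily B C O) (p δ : ℝ × (Fin n → ℝ) × (Fin n → ℝ)) :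
    vvPhi F p δ = (∑ i, (vvU F p i + B i p.2.2) * δ.2.2 i)
      - (∑ i, (((p.1)⁻¹ • vvV F (0, p)) i + B i p.2.1) * δ.2.1 i)
      - ((1:ℝ)/2 * (∑ i, vvU F p i ^ 2) + C p.2.2) * δ.1 := by
  simp [vvPhi]

theorem vvPhi_diff (hB : ∀ i, ContDiff ℝ (⊤ : ℕ∞) (B i)) (hC : ContDiff ℝ (⊤ : ℕ∞) C)
    (F : SmoothFamily B C O) {p : ℝ × (Fin n → ℝ) × (Fin n → ℝ)} (hp : p ∈ O) :
    DifferentiableAt ℝ (vvPhi F) p := by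
  have hU : ∀ i, DifferentiableAt ℝ (fun p => vvU F p i) p := fun i =>
    differentiableAt_pi.1
      (((vvU_smooth F p hp).contDiffAt (F.isOpen.mem_nhds hp)).differentiableAt (by simp)) i
  have hU0 : ∀ i, DifferentiableAt ℝ (fun p => ((p.1)⁻¹ • vvV F (0, p)) i) p := fun i =>
    differentiableAt_pi.1
      (((vvVs_smooth F (s := 0) (by simp) p hp).contDiffAt
        (F.isOpen.mem_nhds hp)).differentiableAt (by simp)) i
  have hB' : ∀ i, Differentiable ℝ (B i) := fun i => (hB i).differentiable (by simp)
  have hC' : Differentiable ℝ C := hC.differentiable (by simp)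
  have h2 : ∀ i, DifferentiableAt ℝ
      (fun p : ℝ × (Fin n → ℝ) × (Fin n → ℝ) => B i p.2.2) p := fun i =>
    DifferentiableAt.comp p (hB' i _) (by fun_prop)
  have h1 : ∀ i, DifferentiableAt ℝ
      (fun p : ℝ × (Fin n → ℝ) × (Fin n → ℝ) => B i p.2.1) p := fun i =>
    DifferentiableAt.comp p (hB' i _) (by fun_prop)
  have h3 : DifferentiableAt ℝ
      (fun p : ℝ × (Fin n → ℝ) × (Fin n → ℝ) => C p.2.2) p :=
    DifferentiableAt.comp p (hC' _) (by fun_prop)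
  refine DifferentiableAt.sub (DifferentiableAt.sub ?_ ?_) ?_
  · exact DifferentiableAt.fun_sum fun i _ => ((hU i).add (h2 i)).smul_const _
  · exact DifferentiableAt.fun_sum fun i _ => ((hU0 i).add (h1 i)).smul_const _
  · exact (((DifferentiableAt.fun_sum fun i _ => (hU i).pow 2).const_mul _).add h3).smul_const _

theorem vv_firstvar (hB : ∀ i, ContDiff ℝ (⊤ : ℕ∞) (B i)) (hC : ContDiff ℝ (⊤ : ℕ∞) C)
    (F : SmoothFamily B C O) {p : ℝ × (Fin n → ℝ) × (Fin n → ℝ)} (hp : p ∈ O) :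
    HasFDerivAt (fun p : ℝ × (Fin n → ℝ) × (Fin n → ℝ) => famS F p.1 p.2.1 p.2.2)
      (vvPhi F p) p := by
  suffices hkey : ∀ δ, ∫ s in (0:ℝ)..1,
      fderivWithin ℝ (vvL F) (Icc (0:ℝ) 1 ×ˢ O) (s, p) (0, δ) = vvPhi F p δ by
    obtain ⟨v', hv', h⟩ := vv_integral_fderiv O F.isOpen (vvL F) (vvL_smooth hB hC F) p hp
      (fun δ => vvPhi F p δ) hkey
    have : v' = vvPhi F p := ContinuousLinearMap.ext hv'
    rw [← this]
    exact h.congr_of_eventuallyEq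
      (by filter_upwards [F.isOpen.mem_nhds hp] with q hq using vvS_eq F hq)
  intro δ
  have hVc : ∀ i, ContinuousOn (fun s : ℝ => vvV F (s, p) i) (Icc 0 1) := fun i =>
    (continuousOn_pi.1 (vvV_smooth F).continuousOn i).comp (by fun_prop)
      (fun s hs => ⟨hs, hp⟩)
  have hGc : ContinuousOn (fun s : ℝ => vvG F (s, p)) (Icc 0 1) :=
    (vvG_smooth F).continuousOn.comp (by fun_prop) (fun s hs => ⟨hs, hp⟩)
  have hηc : ∀ i, ContinuousOn (fun s : ℝ =>
      fderivWithin ℝ (vvG F) (Icc (0:ℝ) 1 ×ˢ O) (s, p) (0, δ) i) (Icc 0 1) := fun i => by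
    have h1 : ContDiffOn ℝ (⊤ : ℕ∞) (fun x =>
      fderivWithin ℝ (vvG F) (Icc (0:ℝ) 1 ×ˢ O) x (0, δ)) (Icc (0:ℝ) 1 ×ˢ O) :=
      ((vvG_smooth F).fderivWithin (vvK_unique F) (by simp)).clm_apply contDiffOn_const
    exact (continuousOn_pi.1 h1.continuousOn i).comp (by fun_prop) (fun s hs => ⟨hs, hp⟩)
  rw [intervalIntegral.integral_eq_sub_of_hasDerivAt_of_le zero_le_one ?_
    (fun s hs => vv_EL hB hC F hp δ hs) ?_]
  · simp only [vvEta_one F hp, vvEta_zero F hp, vvG_one F hp, vvG_zero F hp, vvPhi_apply,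
      vvU_eq F hp, Pi.smul_apply, smul_eq_mul, mul_pow, ← Finset.mul_sum]
    ring
  · refine ContinuousOn.sub ?_ ?_
    · refine continuousOn_finsetSum _ fun i _ => ?_
      refine ContinuousOn.mul (ContinuousOn.add (continuousOn_const.mul (hVc i)) ?_) (hηc i)
      exact (hB i).continuous.comp_continuousOn hGc
    · refine ContinuousOn.mul (by fun_prop) (ContinuousOn.add ?_ ?_)
      · exact continuousOn_const.mul (continuousOn_finsetSum _ fun i _ => (hVc i).pow 2)
      · exact hC.continuous.comp_continuousOn hGc
  · refine ContinuousOn.intervalIntegrable ?_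
    rw [uIcc_of_le zero_le_one]
    have h1 : ContDiffOn ℝ (⊤ : ℕ∞) (fun x =>
      fderivWithin ℝ (vvL F) (Icc (0:ℝ) 1 ×ˢ O) x (0, δ)) (Icc (0:ℝ) 1 ×ˢ O) :=
      ((vvL_smooth hB hC F).fderivWithin (vvK_unique F) (by simp)).clm_apply contDiffOn_const
    exact h1.continuousOn.comp (by fun_prop) (fun s hs => ⟨hs, hp⟩)

theorem vv_gronwall (hB : ∀ i, ContDiff ℝ (⊤ : ℕ∞) (B i)) (hC : ContDiff ℝ (⊤ : ℕ∞) C)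
    (F : SmoothFamily B C O) {p : ℝ × (Fin n → ℝ) × (Fin n → ℝ)} (hp : p ∈ O) :
    ∃ c : ℝ, ∀ᶠ q in nhds p, q.1 = p.1 → q.2.2 = p.2.2 →
      ‖q.2.1 - p.2.1‖ ≤ c * ‖vvU F q - vvU F p‖ := by
  have ht := F.pos p hp
  obtain ⟨r, hr, hball⟩ := Metric.nhds_basis_closedBall.mem_iff.1 (F.isOpen.mem_nhds hp)
  have hinv : ContinuousOn (fun x : ℝ × ℝ × (Fin n → ℝ) × (Fin n → ℝ) => (x.2.1)⁻¹)
      (Icc (0:ℝ) 1 ×ˢ O) :=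
    ContinuousOn.inv₀ (by fun_prop) (fun x hx => (F.pos _ hx.2).ne')
  have hsm : ContinuousOn (fun x : ℝ × ℝ × (Fin n → ℝ) × (Fin n → ℝ) =>
      (x.2.1)⁻¹ • vvV F x) (Icc (0:ℝ) 1 ×ˢ O) :=
    hinv.smul (vvV_smooth F).continuousOn
  obtain ⟨R, hR⟩ := (isCompact_Icc.prod (isCompact_closedBall p r)).exists_bound_of_continuousOn
    (f := fun x : ℝ × ℝ × (Fin n → ℝ) × (Fin n → ℝ) => (vvG F x, (x.2.1)⁻¹ • vvV F x))
    (s := Icc (0:ℝ) 1 ×ˢ Metric.closedBall p r)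
    (((vvG_smooth F).continuousOn.prodMk hsm).mono (prod_mono le_rfl hball))
  let X : (Fin n → ℝ) × (Fin n → ℝ) → (Fin n → ℝ) × (Fin n → ℝ) := fun y =>
    (-y.2, fun i => (∑ j, (pd (B i) j y.1 - pd (B j) i y.1) * y.2 j) + pd C i y.1)
  have hpd : ∀ (f : (Fin n → ℝ) → ℝ) (j : Fin n), ContDiff ℝ (⊤ : ℕ∞) f →
      ContDiff ℝ (⊤ : ℕ∞) (pd f j) := fun f j hf =>
    (hf.fderiv_right (by simp)).clm_apply contDiff_const
  have hX : ContDiff ℝ (⊤ : ℕ∞) X := by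
    refine ContDiff.prodMk (by fun_prop) ?_
    rw [contDiff_pi]
    intro i
    refine ContDiff.add (ContDiff.sum fun j _ => ContDiff.mul (ContDiff.sub ?_ ?_) ?_) ?_
    · exact (hpd _ j (hB i)).comp contDiff_fst
    · exact (hpd _ i (hB j)).comp contDiff_fst
    · fun_prop
    · exact (hpd _ i hC).comp contDiff_fst
  obtain ⟨L, hL⟩ := (hX.contDiffOn (s := Metric.closedBall 0 R)).exists_lipschitzOnWith
    (by simp) (convex_closedBall _ _) (isCompact_closedBall _ _)
  let Y : (ℝ × (Fin n → ℝ) × (Fin n → ℝ)) → ℝ → (Fin n → ℝ) × (Fin n → ℝ) := fun q σ =>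
    (F.f (p.1 - σ) q.1 q.2.1 q.2.2, deriv (fun τ => F.f τ q.1 q.2.1 q.2.2) (p.1 - σ))
  have hYd : ∀ q ∈ O, ∀ σ, HasDerivAt (Y q)
      (-deriv (fun τ => F.f τ q.1 q.2.1 q.2.2) (p.1 - σ),
        -deriv (deriv (fun τ => F.f τ q.1 q.2.1 q.2.2)) (p.1 - σ)) σ := by
    intro q hq σ
    have h0 : ContDiff ℝ (⊤ : ℕ∞) (deriv (fun τ => F.f τ q.1 q.2.1 q.2.2)) :=
      ((contDiff_infty_iff_deriv).1 (F.pathSmooth q hq)).2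
    have h1 : HasDerivAt (fun τ => F.f τ q.1 q.2.1 q.2.2)
        (deriv (fun τ => F.f τ q.1 q.2.1 q.2.2) (p.1 - σ)) (p.1 - σ) :=
      ((F.pathSmooth q hq).contDiffAt.differentiableAt (by simp)).hasDerivAt
    have h2 : HasDerivAt (deriv (fun τ => F.f τ q.1 q.2.1 q.2.2))
        (deriv (deriv (fun τ => F.f τ q.1 q.2.1 q.2.2)) (p.1 - σ)) (p.1 - σ) :=
      (h0.contDiffAt.differentiableAt (by simp)).hasDerivAt
    have e1 := h1.comp_const_sub p.1 σ
    have e2 := h2.comp_const_sub p.1 σ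
    exact e1.prodMk e2
  have hYX : ∀ q ∈ O, q.1 = p.1 → ∀ σ ∈ Ico 0 p.1, HasDerivAt (Y q) (X (Y q σ)) σ := by
    intro q hq hq1 σ hσ
    refine (hYd q hq σ).congr_deriv ?_
    refine Prod.ext rfl ?_
    funext i
    have := F.isClassical q hq (p.1 - σ) ⟨by linarith [hσ.2], by rw [hq1]; linarith [hσ.1]⟩ i
    simp only [X, Y, Pi.neg_apply]
    linarith
  have hYb : ∀ q ∈ Metric.closedBall p r, q.1 = p.1 → ∀ σ ∈ Ico 0 p.1,
      Y q σ ∈ Metric.closedBall 0 R := by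
    intro q hq hq1 σ hσ
    have hs : (p.1 - σ) / p.1 ∈ Icc (0:ℝ) 1 := by
      refine ⟨div_nonneg (by linarith [hσ.2]) ht.le, ?_⟩
      rw [div_le_one ht]; linarith [hσ.1]
    have := hR ((p.1 - σ) / p.1, q) ⟨hs, hq⟩
    rw [mem_closedBall_zero_iff]
    refine le_of_eq_of_le ?_ this
    have e : (p.1 - σ) / p.1 * q.1 = p.1 - σ := by rw [hq1]; field_simp
    congr 1
    refine Prod.ext ?_ ?_
    · simp only [vvG, Y, e]
    · simp only [vvV_eq F (hball hq) hs, smul_smul, Y, e]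
      rw [inv_mul_cancel₀ (by rw [hq1]; exact ht.ne'), one_smul]
  refine ⟨Real.exp (L * (p.1 - 0)), ?_⟩
  filter_upwards [Metric.closedBall_mem_nhds p hr] with q hq hq1 hq2
  have hqO := hball hq
  have hpb : p ∈ Metric.closedBall p r := Metric.mem_closedBall_self hr.le
  have key := dist_le_of_trajectories_ODE_of_mem (v := fun _ => X)
    (s := fun _ => Metric.closedBall 0 R) (K := L) (f := Y q) (g := Y p) (a := 0) (b := p.1)
    (δ := dist (Y q 0) (Y p 0))
    (fun _ _ => hL) (fun σ _ => (hYd q hqO σ).continuousAt.continuousWithinAt)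
    (fun σ hσ => (hYX q hqO hq1 σ hσ).hasDerivWithinAt) (hYb q hq hq1)
    (fun σ _ => (hYd p hp σ).continuousAt.continuousWithinAt)
    (fun σ hσ => (hYX p hp rfl σ hσ).hasDerivWithinAt) (hYb p hpb rfl) le_rfl p.1
    ⟨ht.le, le_rfl⟩
  have e0 : Y q 0 = (q.2.2, vvU F q) := by
    have := F.bdry1 q hqO
    simp only [Y, sub_zero, vvU, ← hq1, this]
  have e0' : Y p 0 = (p.2.2, vvU F p) := by
    have := F.bdry1 p hp
    simp only [Y, sub_zero, vvU, this]
  have e1 : (Y q p.1).1 = q.2.1 := by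
    have := F.bdry0 q hqO
    simp only [Y, sub_self, this]
  have e1' : (Y p p.1).1 = p.2.1 := by
    have := F.bdry0 p hp
    simp only [Y, sub_self, this]
  rw [e0, e0', hq2] at key
  have h1 : dist q.2.1 p.2.1 ≤ dist (Y q p.1) (Y p p.1) := by
    rw [← e1, ← e1', Prod.dist_eq]; exact le_max_left _ _
  have h2 : dist (p.2.2, vvU F q) (p.2.2, vvU F p) = dist (vvU F q) (vvU F p) := by
    rw [Prod.dist_eq, dist_self]; exact max_eq_right dist_nonneg
  rw [h2] at key
  rw [← dist_eq_norm, ← dist_eq_norm, mul_comm]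
  exact h1.trans key

theorem vv_inj (hB : ∀ i, ContDiff ℝ (⊤ : ℕ∞) (B i)) (hC : ContDiff ℝ (⊤ : ℕ∞) C)
    (F : SmoothFamily B C O) {p : ℝ × (Fin n → ℝ) × (Fin n → ℝ)} (hp : p ∈ O)
    (w : Fin n → ℝ) (hw : fderiv ℝ (vvU F) p (0, w, 0) = 0) : w = 0 := by
  obtain ⟨c, hc⟩ := vv_gronwall hB hC F hp
  have hline : HasDerivAt (fun h : ℝ => p + h • ((0, w, 0) : ℝ × (Fin n → ℝ) × (Fin n → ℝ)))
      (0, w, 0) 0 := by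
    simpa using ((hasDerivAt_id (0:ℝ)).smul_const
      ((0, w, 0) : ℝ × (Fin n → ℝ) × (Fin n → ℝ))).const_add p
  have hU : HasFDerivAt (vvU F) (fderiv ℝ (vvU F) p)
      (p + (0:ℝ) • ((0, w, 0) : ℝ × (Fin n → ℝ) × (Fin n → ℝ))) := by
    rw [zero_smul, add_zero]
    exact (((vvU_smooth F p hp).contDiffAt
      (F.isOpen.mem_nhds hp)).differentiableAt (by simp)).hasFDerivAt
  have h1 := hU.comp_hasDerivAt 0 hline
  rw [hw, hasDerivAt_iff_isLittleO] at h1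
  have h2 : (fun h : ℝ => h • w) =O[nhds 0] fun h : ℝ =>
      vvU F (p + h • ((0, w, 0) : ℝ × (Fin n → ℝ) × (Fin n → ℝ))) - vvU F p := by
    refine Asymptotics.IsBigO.of_bound c ?_
    have hcont : Filter.Tendsto (fun h : ℝ =>
        p + h • ((0, w, 0) : ℝ × (Fin n → ℝ) × (Fin n → ℝ))) (nhds 0) (nhds p) := by
      simpa using hline.continuousAt.tendsto
    filter_upwards [hcont.eventually hc] with h hh
    simpa using hh (by simp) (by simp)
  have h3 : HasDerivAt (fun h : ℝ => h • w) 0 0 := by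
    rw [hasDerivAt_iff_isLittleO]
    have h1' : (fun h : ℝ => vvU F (p + h • ((0, w, 0) : ℝ × (Fin n → ℝ) × (Fin n → ℝ)))
        - vvU F p) =o[nhds 0] fun h : ℝ => h := by
      refine h1.congr (fun h => ?_) (fun h => ?_)
      · simp only [Function.comp, zero_smul, smul_zero, add_zero, sub_zero]
      · simp only [sub_zero]
    have h4 := h2.trans_isLittleO h1'
    simpa only [zero_smul, smul_zero, sub_zero] using h4
  have h5 : HasDerivAt (fun h : ℝ => h • w) w 0 := by
    simpa using (hasDerivAt_id (0:ℝ)).smul_const w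
  exact h5.unique h3

theorem vv_det_ne (hB : ∀ i, ContDiff ℝ (⊤ : ℕ∞) (B i)) (hC : ContDiff ℝ (⊤ : ℕ∞) C)
    (F : SmoothFamily B C O) {p : ℝ × (Fin n → ℝ) × (Fin n → ℝ)} (hp : p ∈ O) :
    (Matrix.of fun l m => -(fderiv ℝ (vvU F) p (0, Pi.single l 1, 0) m) :
        Matrix (Fin n) (Fin n) ℝ).det ≠ 0 := by
  intro h
  obtain ⟨w, hw0, hw⟩ := Matrix.exists_vecMul_eq_zero_iff.2 h
  refine hw0 (vv_inj hB hC F hp w ?_)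
  have : ((0, w, 0) : ℝ × (Fin n → ℝ) × (Fin n → ℝ))
      = ∑ l, w l • ((0, Pi.single l 1, 0) : ℝ × (Fin n → ℝ) × (Fin n → ℝ)) := by
    refine Prod.ext ?_ (Prod.ext ?_ ?_)
    · simp [Prod.fst_sum]
    · ext k; simp [Prod.snd_sum, Prod.fst_sum, Finset.sum_apply, Pi.single_apply]
    · simp [Prod.snd_sum]
  rw [this, map_sum]
  ext m
  have := congrFun hw m
  simp only [Matrix.vecMul, dotProduct, Matrix.of_apply, Pi.zero_apply] at this
  simp only [map_smul, Finset.sum_apply, Pi.smul_apply, smul_eq_mul, Pi.zero_apply]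
  simpa [Finset.sum_neg_distrib] using this

theorem vv_pdS (hB : ∀ i, ContDiff ℝ (⊤ : ℕ∞) (B i)) (hC : ContDiff ℝ (⊤ : ℕ∞) C)
    (F : SmoothFamily B C O) {p : ℝ × (Fin n → ℝ) × (Fin n → ℝ)} (hp : p ∈ O) (m : Fin n) :
    fderiv ℝ (fun q => -(famS F p.1 p.2.1 q)) p.2.2 (Pi.single m 1)
      = -(vvU F p m + B m p.2.2) := by
  have h0 : HasFDerivAt (fun q : Fin n → ℝ => ((p.1, p.2.1, q) : ℝ × (Fin n → ℝ) × (Fin n → ℝ)))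
      ((0 : (Fin n → ℝ) →L[ℝ] ℝ).prod ((0 : (Fin n → ℝ) →L[ℝ] (Fin n → ℝ)).prod
        (ContinuousLinearMap.id ℝ (Fin n → ℝ)))) p.2.2 :=
    (hasFDerivAt_const _ _).prodMk ((hasFDerivAt_const _ _).prodMk (hasFDerivAt_id _))
  have h1 : HasFDerivAt (fun q => -(famS F p.1 p.2.1 q)) _ p.2.2 :=
    ((vv_firstvar hB hC F (p := (p.1, p.2.1, p.2.2)) hp).comp p.2.2 h0).neg
  rw [h1.fderiv]
  simp [vvPhi_apply, Pi.single_apply]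

theorem vvU_fderiv (F : SmoothFamily B C O) {p : ℝ × (Fin n → ℝ) × (Fin n → ℝ)} (hp : p ∈ O)
    (m : Fin n) : HasFDerivAt (fun q => vvU F q m)
      ((ContinuousLinearMap.proj (R := ℝ) (φ := fun _ : Fin n => ℝ) m).comp
        (fderiv ℝ (vvU F) p)) p :=
  (hasFDerivAt_pi'.1 (((vvU_smooth F p hp).contDiffAt
      (F.isOpen.mem_nhds hp)).differentiableAt (by simp)).hasFDerivAt) m

theorem vv_hess (hB : ∀ i, ContDiff ℝ (⊤ : ℕ∞) (B i)) (hC : ContDiff ℝ (⊤ : ℕ∞) C)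
    (F : SmoothFamily B C O) {p : ℝ × (Fin n → ℝ) × (Fin n → ℝ)} (hp : p ∈ O) :
    Hess01 (fun a b c => -(famS F a b c)) p.1 p.2.1 p.2.2
      = Matrix.of fun l m => -(fderiv ℝ (vvU F) p (0, Pi.single l 1, 0) m) := by
  ext l m
  simp only [Hess01, Matrix.of_apply]
  have h0 : HasFDerivAt (fun q : Fin n → ℝ => ((p.1, q, p.2.2) : ℝ × (Fin n → ℝ) × (Fin n → ℝ)))
      ((0 : (Fin n → ℝ) →L[ℝ] ℝ).prod
        ((ContinuousLinearMap.id ℝ (Fin n → ℝ)).prod (0 : (Fin n → ℝ) →L[ℝ] (Fin n → ℝ))))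
      p.2.1 :=
    (hasFDerivAt_const _ _).prodMk ((hasFDerivAt_id _).prodMk (hasFDerivAt_const _ _))
  have hev : (fun q0' => fderiv ℝ (fun q1' => -(famS F p.1 q0' q1')) p.2.2 (Pi.single m 1))
      =ᶠ[nhds p.2.1] fun q0' => -(vvU F (p.1, q0', p.2.2) m + B m p.2.2) := by
    filter_upwards [h0.continuousAt.preimage_mem_nhds (F.isOpen.mem_nhds hp)] with q hq
    exact vv_pdS hB hC F (p := (p.1, q, p.2.2)) hq m
  have h1 : HasFDerivAt (fun q0' => -(vvU F (p.1, q0', p.2.2) m + B m p.2.2)) _ p.2.1 :=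
    (((vvU_fderiv F (p := (p.1, p.2.1, p.2.2)) hp m).comp p.2.1 h0).add_const _).neg
  rw [hev.fderiv_eq, h1.fderiv]
  simp

end VVFamily

/-- the logarithm of the Van Vleck determinant satisfies the transport
equation; equivalently, the determinant satisfies the continuity equation. -/
theorem statement3 {n : ℕ} (hn : 1 ≤ n)
    (B : Fin n → (Fin n → ℝ) → ℝ) (C : (Fin n → ℝ) → ℝ)
    (hB : ∀ i, ContDiff ℝ (⊤ : ℕ∞) (B i)) (hC : ContDiff ℝ (⊤ : ℕ∞) C)
    (O : Set (ℝ × (Fin n → ℝ) × (Fin n → ℝ))) (F : SmoothFamily B C O)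
    (t : ℝ) (q0 q1 : Fin n → ℝ) (hmem : (t, q0, q1) ∈ O) :
    deriv (fun s => (1:ℝ)/2 *
        Real.log |(Hess01 (fun a b c => -(famS F a b c)) s q0 q1).det|) t
      = (∑ j, (pd (fun q => -(famS F t q0 q)) j q1 + B j q1)
            * pd (fun q => (1:ℝ)/2 *
                Real.log |(Hess01 (fun a b c => -(famS F a b c)) t q0 q).det|) j q1)
        + (1:ℝ)/2 * (∑ j, pd (fun q => pd (fun q' => -(famS F t q0 q')) j q) j q1)
        + (1:ℝ)/2 * (∑ j, pd (B j) j q1) ∧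
    deriv (fun s => (Hess01 (fun a b c => -(famS F a b c)) s q0 q1).det) t
      + (∑ j, pd (fun q => (Hess01 (fun a b c => -(famS F a b c)) t q0 q).det
            * deriv (fun τ => F.f τ t q0 q) t j) j q1)
      = 0 := by
  set p : ℝ × (Fin n → ℝ) × (Fin n → ℝ) := (t, q0, q1) with hpdef
  have hp : p ∈ O := hmem
  let D : ℝ × (Fin n → ℝ) × (Fin n → ℝ) → ℝ := fun p =>
    (Hess01 (fun a b c => -(famS F a b c)) p.1 p.2.1 p.2.2).det
  obtain ⟨hDd, hT⟩ := vv_transport O F.isOpen B C hB hC (vvU F) (vvU_smooth F)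
    (fun p => famS F p.1 p.2.1 p.2.2) (vvPhi F) (fun p hp => vv_firstvar hB hC F hp)
    (fun p hp => vvPhi_diff hB hC F hp)
    (fun p _ m => by simp [vvPhi_apply, Pi.single_apply])
    (fun p _ => by simp [vvPhi_apply])
    D (fun p hp => by simp only [D]; rw [vv_hess hB hC F hp]) p hp
  have hD0 : D p ≠ 0 := by
    have h := vv_det_ne hB hC F hp
    rw [← vv_hess hB hC F hp] at h
    exact h
  -- the coordinate lines
  have h0 : HasFDerivAt (fun q : Fin n → ℝ => ((t, q0, q) : ℝ × (Fin n → ℝ) × (Fin n → ℝ)))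
      ((0 : (Fin n → ℝ) →L[ℝ] ℝ).prod ((0 : (Fin n → ℝ) →L[ℝ] (Fin n → ℝ)).prod
        (ContinuousLinearMap.id ℝ (Fin n → ℝ)))) q1 :=
    (hasFDerivAt_const _ _).prodMk ((hasFDerivAt_const _ _).prodMk (hasFDerivAt_id _))
  have ht0 : HasDerivAt (fun s : ℝ => ((s, q0, q1) : ℝ × (Fin n → ℝ) × (Fin n → ℝ)))
      (1, 0, 0) t :=
    (hasDerivAt_id t).prodMk ((hasDerivAt_const _ _).prodMk (hasDerivAt_const _ _))
  have hDt : HasDerivAt (fun s => D (s, q0, q1)) (fderiv ℝ D p (1, 0, 0)) t :=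
    HasFDerivAt.comp_hasDerivAt t (f := fun s : ℝ => (s, q0, q1)) hDd.hasFDerivAt ht0
  have hDq : HasFDerivAt (fun q => D (t, q0, q)) ((fderiv ℝ D p).comp
      ((0 : (Fin n → ℝ) →L[ℝ] ℝ).prod ((0 : (Fin n → ℝ) →L[ℝ] (Fin n → ℝ)).prod
        (ContinuousLinearMap.id ℝ (Fin n → ℝ))))) q1 :=
    HasFDerivAt.comp q1 (f := fun q : Fin n → ℝ => (t, q0, q)) hDd.hasFDerivAt h0
  have hUq : ∀ j, HasFDerivAt (fun q => vvU F (t, q0, q) j)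
      (((ContinuousLinearMap.proj (R := ℝ) (φ := fun _ : Fin n => ℝ) j).comp
        (fderiv ℝ (vvU F) p)).comp
      ((0 : (Fin n → ℝ) →L[ℝ] ℝ).prod ((0 : (Fin n → ℝ) →L[ℝ] (Fin n → ℝ)).prod
        (ContinuousLinearMap.id ℝ (Fin n → ℝ))))) q1 := fun j =>
    HasFDerivAt.comp q1 (f := fun q : Fin n → ℝ => (t, q0, q)) (vvU_fderiv F hp j) h0
  constructor
  · have e1 : deriv (fun s => (1:ℝ)/2 *
        Real.log |(Hess01 (fun a b c => -(famS F a b c)) s q0 q1).det|) t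
        = 1/2 * (fderiv ℝ D p (1, 0, 0) / D p) := by
      have h := (hDt.log hD0).const_mul ((1:ℝ)/2)
      simp only [Real.log_abs]
      exact h.deriv
    have e2 : ∀ j, pd (fun q => (1:ℝ)/2 *
        Real.log |(Hess01 (fun a b c => -(famS F a b c)) t q0 q).det|) j q1
        = 1/2 * (fderiv ℝ D p (0, 0, Pi.single j 1) / D p) := by
      intro j
      have h : HasFDerivAt (fun q => (1:ℝ)/2 *
        Real.log (Hess01 (fun a b c => -(famS F a b c)) t q0 q).det) _ q1 :=
        (hDq.log hD0).const_mul ((1:ℝ)/2)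
      simp only [Real.log_abs, pd]
      rw [h.fderiv]
      simp only [_root_.smul_apply, ContinuousLinearMap.comp_apply,
        ContinuousLinearMap.prod_apply, _root_.zero_apply,
        ContinuousLinearMap.id_apply, smul_eq_mul, hpdef]
      ring
    have e3 : ∀ j, pd (fun q => -(famS F t q0 q)) j q1 = -(vvU F p j + B j q1) :=
      fun j => vv_pdS hB hC F hp j
    have e4 : ∀ j, pd (fun q => pd (fun q' => -(famS F t q0 q')) j q) j q1
        = -(fderiv ℝ (vvU F) p (0, 0, Pi.single j 1) j + pd (B j) j q1) := by
      intro j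
      have hev : (fun q => pd (fun q' => -(famS F t q0 q')) j q)
          =ᶠ[nhds q1] fun q => -(vvU F (t, q0, q) j + B j q) := by
        filter_upwards [h0.continuousAt.preimage_mem_nhds (F.isOpen.mem_nhds hp)] with q hq
        exact vv_pdS hB hC F (p := (t, q0, q)) hq j
      have hBj : HasFDerivAt (B j) (fderiv ℝ (B j) q1) q1 :=
        ((hB j).differentiable (by simp) q1).hasFDerivAt
      have h : HasFDerivAt (fun q => -(vvU F (t, q0, q) j + B j q)) _ q1 :=
        ((hUq j).add hBj).neg
      rw [pd, hev.fderiv_eq, h.fderiv]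
      simp [pd]
    simp only [e1, e2, e3, e4]
    have e5 : fderiv ℝ D p (1, 0, 0) / D p
        = -(∑ j, vvU F p j * (fderiv ℝ D p (0, 0, Pi.single j 1) / D p))
          - ∑ j, fderiv ℝ (vvU F) p (0, 0, Pi.single j 1) j := by
      have : ∑ j, vvU F p j * (fderiv ℝ D p (0, 0, Pi.single j 1) / D p)
          = (∑ j, vvU F p j * fderiv ℝ D p (0, 0, Pi.single j 1)) / D p := by
        rw [Finset.sum_div]
        exact Finset.sum_congr rfl fun j _ => by ring
      rw [this]
      field_simp
      linarith
    rw [e5, Finset.sum_neg_distrib, Finset.sum_add_distrib]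
    have e6 : ∑ j, (-(vvU F p j + B j q1) + B j q1)
          * (1/2 * (fderiv ℝ D p (0, 0, Pi.single j 1) / D p))
        = -(1/2) * ∑ j, vvU F p j * (fderiv ℝ D p (0, 0, Pi.single j 1) / D p) := by
      rw [Finset.mul_sum]
      exact Finset.sum_congr rfl fun j _ => by ring
    rw [e6]
    ring
  · have e1 : deriv (fun s => (Hess01 (fun a b c => -(famS F a b c)) s q0 q1).det) t
        = fderiv ℝ D p (1, 0, 0) := hDt.deriv
    have e2 : ∀ j, pd (fun q => (Hess01 (fun a b c => -(famS F a b c)) t q0 q).det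
            * deriv (fun τ => F.f τ t q0 q) t j) j q1
        = vvU F p j * fderiv ℝ D p (0, 0, Pi.single j 1)
          + D p * fderiv ℝ (vvU F) p (0, 0, Pi.single j 1) j := by
      intro j
      have h : HasFDerivAt (fun q => (Hess01 (fun a b c => -(famS F a b c)) t q0 q).det
            * deriv (fun τ => F.f τ t q0 q) t j) _ q1 := hDq.mul (hUq j)
      rw [pd, h.fderiv]
      simp only [_root_.add_apply, _root_.smul_apply,
        ContinuousLinearMap.comp_apply, ContinuousLinearMap.prod_apply,
        _root_.zero_apply, ContinuousLinearMap.id_apply, smul_eq_mul,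
        ContinuousLinearMap.proj_apply, hpdef]
      exact add_comm _ _
    simp only [e1, e2]
    rw [Finset.sum_add_distrib, ← Finset.mul_sum]
    linarith
end
end

section
/- Let γ be a smooth family of nondegenerate classical paths over an open set O ⊆ ℝ_{>0} × ℝ^n × ℝ^n with Hamilton function S_γ. Then for all (t,q_0,q_1) ∈ O and all indices l, m: ∂²S_γ/∂q_0^l∂q_1^m (t,q_0,q_1) = ∂/∂q_0^l [γ̇^m(t;t,q_0,q_1)], the derivative at fixed (t,q_1) of the terminal velocity of the family member; moreover this n×n matrix is invertible. -/
open MeasureTheory Set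
open scoped BigOperators

noncomputable section

section Generic
open scoped ContDiff Topology

variable {E G : Type*} [NormedAddCommGroup E] [NormedSpace ℝ E]
  [NormedAddCommGroup G] [NormedSpace ℝ G]

theorem slab_uniqueDiffOn {t : ℝ} (ht : 0 < t) {U : Set E} (hU : IsOpen U) :
    UniqueDiffOn ℝ (Icc (0:ℝ) t ×ˢ U) :=
  (uniqueDiffOn_Icc ht).prod hU.uniqueDiffOn

theorem slab_mem_closure {t : ℝ} (ht : 0 < t) {U : Set E} (hU : IsOpen U)
    {p : ℝ × E} (hp : p ∈ Icc (0:ℝ) t ×ˢ U) : p ∈ closure (interior (Icc (0:ℝ) t ×ˢ U)) := by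
  rw [interior_prod_eq, interior_Icc, hU.interior_eq, closure_prod_eq, closure_Ioo ht.ne]
  exact ⟨hp.1, subset_closure hp.2⟩

theorem slab_time {t : ℝ} {U : Set E} {h : ℝ × E → G} {τ : ℝ} {e : E}
    {h' : ℝ × E →L[ℝ] G}
    (he : e ∈ U) (hd : HasFDerivWithinAt h h' (Icc (0:ℝ) t ×ˢ U) (τ, e)) :
    HasDerivWithinAt (fun σ => h (σ, e)) (h' (1, 0)) (Icc 0 t) τ := by
  have h1 : HasDerivWithinAt (fun σ : ℝ => (σ, e)) ((1:ℝ), (0:E)) (Icc 0 t) τ :=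
    (hasDerivAt_id τ).hasDerivWithinAt.prodMk (hasDerivWithinAt_const τ _ e)
  have h2 : MapsTo (fun σ : ℝ => (σ, e)) (Icc 0 t) (Icc (0:ℝ) t ×ˢ U) := fun σ hσ => ⟨hσ, he⟩
  exact hd.comp_hasDerivWithinAt τ h1 h2

theorem slab_space {t : ℝ} {U : Set E} (hU : IsOpen U) {h : ℝ × E → G} {τ : ℝ} {e : E}
    {h' : ℝ × E →L[ℝ] G} (hτ : τ ∈ Icc (0:ℝ) t)
    (he : e ∈ U) (hd : HasFDerivWithinAt h h' (Icc (0:ℝ) t ×ˢ U) (τ, e)) :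
    HasFDerivAt (fun x => h (τ, x)) (h'.comp (ContinuousLinearMap.inr ℝ ℝ E)) e := by
  have h1 : HasFDerivWithinAt (fun x : E => (τ, x)) (ContinuousLinearMap.inr ℝ ℝ E) U e :=
    (hasFDerivAt_prodMk_right τ e).hasFDerivWithinAt
  have h2 := hd.comp e h1 (fun x hx => ⟨hτ, hx⟩)
  exact h2.hasFDerivAt (hU.mem_nhds he)

/-- Mixed derivatives commute. -/
theorem slab_symm {t : ℝ} (ht : 0 < t) {U : Set E} (hU : IsOpen U) {h : ℝ × E → G}
    (hh : ContDiffOn ℝ ∞ h (Icc (0:ℝ) t ×ˢ U)) {τ : ℝ} {e : E}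
    (hτ : τ ∈ Icc (0:ℝ) t) (he : e ∈ U) (w : E)
    {v : ℝ × E → G} (hv : ∀ p ∈ Icc (0:ℝ) t ×ˢ U,
      v p = fderivWithin ℝ h (Icc (0:ℝ) t ×ˢ U) p (1, 0)) {v' : ℝ × E →L[ℝ] G}
    (hv' : HasFDerivWithinAt v v' (Icc (0:ℝ) t ×ˢ U) (τ, e)) :
    HasDerivWithinAt (fun σ => fderivWithin ℝ h (Icc (0:ℝ) t ×ˢ U) (σ, e) (0, w))
      (v' (0, w)) (Icc 0 t) τ := by
  have hs := slab_uniqueDiffOn ht hU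
  set s := Icc (0:ℝ) t ×ˢ U with hsdef
  have hp : (τ, e) ∈ s := ⟨hτ, he⟩
  have hD : ContDiffOn ℝ ∞ (fderivWithin ℝ h s) s := hh.fderivWithin hs (by simp)
  have hDd : HasFDerivWithinAt (fderivWithin ℝ h s) (fderivWithin ℝ (fderivWithin ℝ h s) s (τ, e)) s
      (τ, e) := ((hD.differentiableOn (by simp)) _ hp).hasFDerivWithinAt
  have hsym : IsSymmSndFDerivWithinAt ℝ h s (τ, e) :=
    (hh _ hp).isSymmSndFDerivWithinAt (by
      rw [minSmoothness_of_isRCLikeNormedField]; exact ENat.LEInfty.out) hs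
      (slab_mem_closure ht hU hp) hp
  have h1 := slab_time he (hDd.clm_apply (hasFDerivWithinAt_const ((0:ℝ), w) (τ, e) s))
  have h2 := (hDd.clm_apply (hasFDerivWithinAt_const ((1:ℝ), (0:E)) (τ, e) s)).congr hv (hv _ hp)
  have h3 : v' = _ := (hs _ hp).eq hv' h2
  have h4 := hsym (1, 0) (0, w)
  convert h1 using 1
  rw [h3]
  simp [h4]

/-- If the linearised solution vanishes at time `t`, it vanishes at time `0`. -/
theorem slab_ode {t : ℝ} (ht : 0 < t) {U : Set E} (hU : IsOpen U) {x : ℝ × E → G}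
    (hx : ContDiffOn ℝ ∞ x (Icc (0:ℝ) t ×ˢ U)) {X : G → G} (hX : ContDiff ℝ ∞ X)
    (hode : ∀ p ∈ Icc (0:ℝ) t ×ˢ U,
      X (x p) = fderivWithin ℝ x (Icc (0:ℝ) t ×ˢ U) p (1, 0)) {e : E} (he : e ∈ U) (w : E)
    (hz : fderivWithin ℝ x (Icc (0:ℝ) t ×ˢ U) (t, e) (0, w) = 0) :
    fderivWithin ℝ x (Icc (0:ℝ) t ×ˢ U) (0, e) (0, w) = 0 := by
  have hs := slab_uniqueDiffOn ht hU
  set s := Icc (0:ℝ) t ×ˢ U with hsdef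
  set y : ℝ → G := fun σ => fderivWithin ℝ x s (σ, e) (0, w) with hy
  have hyd : ∀ τ ∈ Icc (0:ℝ) t,
      HasDerivWithinAt y (fderiv ℝ X (x (τ, e)) (y τ)) (Icc 0 t) τ := by
    intro τ hτ
    have hp : (τ, e) ∈ s := ⟨hτ, he⟩
    have h1 : HasFDerivWithinAt x (fderivWithin ℝ x s (τ, e)) s (τ, e) :=
      (hx.differentiableOn (by simp) _ hp).hasFDerivWithinAt
    have h2 : HasFDerivAt X (fderiv ℝ X (x (τ, e))) (x (τ, e)) :=
      (hX.differentiable (by simp) _).hasFDerivAt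
    exact slab_symm ht hU hx hτ he w (v := fun p => X (x p)) hode (h2.comp_hasFDerivWithinAt _ h1)
  have hyc : ContinuousOn y (Icc 0 t) := fun τ hτ => (hyd τ hτ).continuousWithinAt
  have hxc : ContinuousOn (fun τ => x (τ, e)) (Icc 0 t) :=
    hx.continuousOn.comp (by fun_prop) (fun τ hτ => ⟨hτ, he⟩)
  have hAc : ContinuousOn (fun τ => fderiv ℝ X (x (τ, e))) (Icc 0 t) :=
    (hX.continuous_fderiv (by simp)).comp_continuousOn hxc
  obtain ⟨K, hK⟩ := isCompact_Icc.exists_bound_of_continuousOn hAc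
  have key := ODE_solution_unique_of_mem_Icc_left (v := fun τ z => fderiv ℝ X (x (τ, e)) z)
    (K := K.toNNReal) (s := fun _ => univ) (f := y) (g := fun _ => 0) (a := 0) (b := t)
    (fun τ hτ => by
      refine LipschitzWith.lipschitzOnWith ?_
      refine (fderiv ℝ X (x (τ, e))).lipschitz.weaken ?_
      rw [← NNReal.coe_le_coe]
      exact (hK τ ⟨hτ.1.le, hτ.2⟩).trans (Real.le_coe_toNNReal K))
    hyc
    (fun τ hτ => by
      refine (hyd τ ⟨hτ.1.le, hτ.2⟩).mono_of_mem_nhdsWithin ?_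
      exact Filter.mem_of_superset (Icc_mem_nhdsLE hτ.1) (Icc_subset_Icc_right hτ.2))
    (fun _ _ => trivial) continuousOn_const
    (fun τ hτ => by simpa using hasDerivWithinAt_const τ (Iic τ) (0:G))
    (fun _ _ => trivial) hz
  exact key ⟨le_rfl, ht.le⟩

/-- Differentiation under the integral sign, when the derivative of the integrand is a total
time derivative. -/
theorem slab_integral [ProperSpace E] {t : ℝ} (ht : 0 < t) {U : Set E} (hU : IsOpen U)
    {ell : ℝ × E → ℝ} (hl : ContDiffOn ℝ ∞ ell (Icc (0:ℝ) t ×ˢ U)) {e : E} (he : e ∈ U) :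
    ∃ T : E →L[ℝ] ℝ, HasFDerivAt (fun x => ∫ τ in (0:ℝ)..t, ell (τ, x)) T e ∧
      ∀ (w : E) (P : ℝ → ℝ), (∀ τ ∈ Icc (0:ℝ) t,
        HasDerivWithinAt P (fderivWithin ℝ ell (Icc (0:ℝ) t ×ˢ U) (τ, e) (0, w)) (Icc 0 t) τ) →
        T w = P t - P 0 := by
  have hs := slab_uniqueDiffOn ht hU
  set s := Icc (0:ℝ) t ×ˢ U with hsdef
  obtain ⟨ε, hε, hεU⟩ := Metric.nhds_basis_closedBall.mem_iff.1 (hU.mem_nhds he)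
  have hDc : ContinuousOn (fderivWithin ℝ ell s) s := hl.continuousOn_fderivWithin hs (by simp)
  set F' : E → ℝ → E →L[ℝ] ℝ := fun x τ =>
    (fderivWithin ℝ ell s (τ, x)).comp (ContinuousLinearMap.inr ℝ ℝ E) with hF'
  have hF'c : ContinuousOn (fun p : ℝ × E => F' p.2 p.1) s := by
    exact hDc.clm_comp continuousOn_const
  obtain ⟨M, hM⟩ := (isCompact_Icc.prod (isCompact_closedBall e ε)).exists_bound_of_continuousOn
    (hF'c.mono (prod_mono_right hεU))
  have hIoc : Set.uIoc 0 t ⊆ Icc 0 t := by rw [uIoc_of_le ht.le]; exact Ioc_subset_Icc_self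
  have hlc : ∀ x ∈ U, ContinuousOn (fun τ => ell (τ, x)) (Icc 0 t) := fun x hx =>
    hl.continuousOn.comp (by fun_prop) (fun τ hτ => ⟨hτ, hx⟩)
  have hF'ec : ContinuousOn (F' e) (Icc 0 t) :=
    hF'c.comp (f := fun τ : ℝ => (τ, e)) (by fun_prop) (fun τ hτ => ⟨hτ, he⟩)
  have hF'i : IntervalIntegrable (F' e) volume 0 t :=
    (hF'ec.mono (by rw [uIcc_of_le ht.le])).intervalIntegrable
  have main := intervalIntegral.hasFDerivAt_integral_of_dominated_of_fderiv_le (μ := volume)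
    (F := fun x τ => ell (τ, x)) (F' := F') (a := 0) (b := t) (x₀ := e)
    (bound := fun _ => M) (Metric.closedBall_mem_nhds e hε)
    (Filter.eventually_of_mem (hU.mem_nhds he) fun x hx =>
      ((hlc x hx).mono hIoc).aestronglyMeasurable measurableSet_uIoc)
    ((hlc e he).mono (by rw [uIcc_of_le ht.le])).intervalIntegrable
    ((hF'ec.mono hIoc).aestronglyMeasurable measurableSet_uIoc)
    (Filter.Eventually.of_forall fun τ hτ x hx => hM (τ, x) ⟨hIoc hτ, hx⟩)
    (by simp)
    (Filter.Eventually.of_forall fun τ hτ x hx =>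
      slab_space hU (hIoc hτ) (hεU hx)
        ((hl.differentiableOn (by simp) _ ⟨hIoc hτ, hεU hx⟩).hasFDerivWithinAt))
  refine ⟨_, main, fun w P hP => ?_⟩
  rw [ContinuousLinearMap.intervalIntegral_apply hF'i]
  have hw : ContinuousOn (fun τ => F' e τ w) (Icc 0 t) := hF'ec.clm_apply continuousOn_const
  refine intervalIntegral.integral_eq_sub_of_hasDerivAt_of_le ht.le
    (fun τ hτ => (hP τ hτ).continuousWithinAt) (fun τ hτ => ?_)
    ((hw.mono (by rw [uIcc_of_le ht.le])).intervalIntegrable)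
  exact (hP τ (Ioo_subset_Icc_self hτ)).hasDerivAt (Icc_mem_nhds hτ.1 hτ.2)

end Generic

section Main
open scoped ContDiff Topology

theorem fderiv_eq_sum_pd {n : ℕ} (f : (Fin n → ℝ) → ℝ) (q u : Fin n → ℝ) :
    fderiv ℝ f q u = ∑ j, u j * pd f j q := by
  conv_lhs => rw [pi_eq_sum_univ' u]
  simp only [map_sum, map_smul, smul_eq_mul, pd]

theorem pd_contDiff {n : ℕ} {f : (Fin n → ℝ) → ℝ} (hf : ContDiff ℝ ∞ f) (j : Fin n) :
    ContDiff ℝ ∞ (pd f j) :=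
  (hf.fderiv_right (m := ∞) (by simp)).clm_apply contDiff_const

variable {n : ℕ} {B : Fin n → (Fin n → ℝ) → ℝ} {C : (Fin n → ℝ) → ℝ}
    {O : Set (ℝ × (Fin n → ℝ) × (Fin n → ℝ))} (F : SmoothFamily B C O)

/-- parameters at fixed duration -/
def sliceU (O : Set (ℝ × (Fin n → ℝ) × (Fin n → ℝ))) (t : ℝ) :
    Set ((Fin n → ℝ) × (Fin n → ℝ)) := {e | (t, e) ∈ O}

/-- domain at fixed duration -/
def slabS (O : Set (ℝ × (Fin n → ℝ) × (Fin n → ℝ))) (t : ℝ) :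
    Set (ℝ × (Fin n → ℝ) × (Fin n → ℝ)) := Icc (0:ℝ) t ×ˢ sliceU O t

/-- position -/
def posF (t : ℝ) (p : ℝ × (Fin n → ℝ) × (Fin n → ℝ)) : Fin n → ℝ := F.f p.1 t p.2.1 p.2.2

/-- velocity -/
def velF (t : ℝ) (p : ℝ × (Fin n → ℝ) × (Fin n → ℝ)) : Fin n → ℝ :=
  deriv (fun τ => F.f τ t p.2.1 p.2.2) p.1

theorem sliceU_open (F : SmoothFamily B C O) (t : ℝ) : IsOpen (sliceU O t) :=
  F.isOpen.preimage (by fun_prop : Continuous fun e : (Fin n → ℝ) × (Fin n → ℝ) => (t, e))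

theorem posF_smooth (t : ℝ) : ContDiffOn ℝ ∞ (posF F t) (slabS O t) := by
  have h : ContDiff ℝ ∞ (fun p : ℝ × (Fin n → ℝ) × (Fin n → ℝ) => (p.1, t, p.2)) := by fun_prop
  exact F.smooth.comp h.contDiffOn (fun p hp => ⟨hp.2, hp.1⟩)

theorem slabS_unique (F : SmoothFamily B C O) {t : ℝ} (ht : 0 < t) :
    UniqueDiffOn ℝ (slabS O t) := slab_uniqueDiffOn ht (sliceU_open F t)

theorem velF_eq {t : ℝ} (ht : 0 < t) : ∀ p ∈ slabS O t,
    velF F t p = fderivWithin ℝ (posF F t) (slabS O t) p (1, 0) := by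
  rintro ⟨τ, e⟩ hp
  have h1 := slab_time hp.2
    (((posF_smooth F t).differentiableOn (by simp)) _ hp).hasFDerivWithinAt
  have h2 : HasDerivAt (fun τ => F.f τ t e.1 e.2) (velF F t (τ, e)) τ :=
    (((F.pathSmooth (t, e) hp.2).differentiable (by simp)) τ).hasDerivAt
  exact (uniqueDiffOn_Icc ht τ hp.1).eq_deriv _ h2.hasDerivWithinAt h1

theorem velF_smooth {t : ℝ} (ht : 0 < t) : ContDiffOn ℝ ∞ (velF F t) (slabS O t) := by
  refine ContDiffOn.congr ?_ (velF_eq F ht)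
  exact ((posF_smooth F t).fderivWithin (slabS_unique F ht) (by simp)).clm_apply contDiffOn_const

theorem acc_eq {t : ℝ} (ht : 0 < t) : ∀ p ∈ slabS O t, ∀ i,
    fderivWithin ℝ (velF F t) (slabS O t) p (1, 0) i =
      -(∑ j, (pd (B i) j (posF F t p) - pd (B j) i (posF F t p)) * velF F t p j)
        - pd C i (posF F t p) := by
  rintro ⟨τ, e⟩ hp i
  have h1 := slab_time hp.2
    (((velF_smooth F ht).differentiableOn (by simp)) _ hp).hasFDerivWithinAt
  have hc : ContDiff ℝ ∞ (deriv fun τ => F.f τ t e.1 e.2) :=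
    ((contDiff_infty_iff_deriv).1 (F.pathSmooth (t, e) hp.2)).2
  have h2 : HasDerivAt (deriv fun τ => F.f τ t e.1 e.2)
      (deriv (deriv fun τ => F.f τ t e.1 e.2) τ) τ :=
    ((hc.differentiable (by simp)) τ).hasDerivAt
  have h3 := (uniqueDiffOn_Icc ht τ hp.1).eq_deriv _ h2.hasDerivWithinAt h1
  have h4 := F.isClassical (t, e) hp.2 τ hp.1 i
  have h5 := congrFun h3 i
  simp only at h4 h5
  change _ = -(∑ j, (pd (B i) j (F.f τ t e.1 e.2) - pd (B j) i (F.f τ t e.1 e.2)) *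
    deriv (fun τ => F.f τ t e.1 e.2) τ j) - pd C i (F.f τ t e.1 e.2)
  rw [show (fderivWithin ℝ (velF F t) (slabS O t) (τ, e)) (1, 0) i = _ from h5.symm]
  linarith

theorem pos_end {t : ℝ} (ht : 0 < t) {e : (Fin n → ℝ) × (Fin n → ℝ)} (he : e ∈ sliceU O t)
    (w : (Fin n → ℝ) × (Fin n → ℝ)) :
    fderivWithin ℝ (posF F t) (slabS O t) (t, e) (0, w) = w.2 := by
  have hp : (t, e) ∈ slabS O t := ⟨⟨ht.le, le_rfl⟩, he⟩
  have h1 := slab_space (sliceU_open F t) hp.1 he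
    (((posF_smooth F t).differentiableOn (by simp)) _ hp).hasFDerivWithinAt
  have h2 : HasFDerivAt (fun x => posF F t (t, x)) (ContinuousLinearMap.snd ℝ _ _) e :=
    hasFDerivAt_snd.congr_of_eventuallyEq
      (Filter.eventually_of_mem ((sliceU_open F t).mem_nhds he) fun x hx => F.bdry1 (t, x) hx)
  have := congrArg (fun L => L w) (h1.unique h2)
  simpa using this

theorem pos_start {t : ℝ} (ht : 0 < t) {e : (Fin n → ℝ) × (Fin n → ℝ)} (he : e ∈ sliceU O t)
    (w : (Fin n → ℝ) × (Fin n → ℝ)) :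
    fderivWithin ℝ (posF F t) (slabS O t) (0, e) (0, w) = w.1 := by
  have hp : (0, e) ∈ slabS O t := ⟨⟨le_rfl, ht.le⟩, he⟩
  have h1 := slab_space (sliceU_open F t) hp.1 he
    (((posF_smooth F t).differentiableOn (by simp)) _ hp).hasFDerivWithinAt
  have h2 : HasFDerivAt (fun x => posF F t (0, x)) (ContinuousLinearMap.fst ℝ _ _) e :=
    hasFDerivAt_fst.congr_of_eventuallyEq
      (Filter.eventually_of_mem ((sliceU_open F t).mem_nhds he) fun x hx => F.bdry0 (t, x) hx)
  have := congrArg (fun L => L w) (h1.unique h2)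
  simpa using this

/-- A Jacobi field vanishing to first order at the end vanishes at the start. -/
theorem kernel_trivial (hB : ∀ i, ContDiff ℝ ∞ (B i)) (hC : ContDiff ℝ ∞ C)
    {t : ℝ} (ht : 0 < t) {e : (Fin n → ℝ) × (Fin n → ℝ)} (he : e ∈ sliceU O t)
    (c : Fin n → ℝ) (hc : fderivWithin ℝ (velF F t) (slabS O t) (t, e) (0, (c, 0)) = 0) :
    c = 0 := by
  set X : (Fin n → ℝ) × (Fin n → ℝ) → (Fin n → ℝ) × (Fin n → ℝ) := fun z =>
    (z.2, fun i => -(∑ j, (pd (B i) j z.1 - pd (B j) i z.1) * z.2 j) - pd C i z.1) with hX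
  have hXs : ContDiff ℝ ∞ X := by
    have h1 : ∀ i j, ContDiff ℝ ∞ (pd (B i) j) := fun i j => pd_contDiff (hB i) j
    have h2 : ∀ i, ContDiff ℝ ∞ (pd C i) := fun i => pd_contDiff hC i
    refine contDiff_snd.prodMk (contDiff_pi.2 fun i => ?_)
    refine (ContDiff.neg (ContDiff.sum fun j _ => ?_)).sub ((h2 i).comp contDiff_fst)
    refine (((h1 i j).comp contDiff_fst).sub ((h1 j i).comp contDiff_fst)).mul ?_
    exact (contDiff_apply ℝ ℝ j).comp contDiff_snd
  have hU := sliceU_open F t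
  have hs := slabS_unique F ht
  have hD : ∀ p ∈ slabS O t, fderivWithin ℝ (fun p => (posF F t p, velF F t p)) (slabS O t) p =
      (fderivWithin ℝ (posF F t) (slabS O t) p).prod
        (fderivWithin ℝ (velF F t) (slabS O t) p) := fun p hp =>
    HasFDerivWithinAt.fderivWithin
      ((((posF_smooth F t).differentiableOn (by simp)) _ hp).hasFDerivWithinAt.prodMk
        (((velF_smooth F ht).differentiableOn (by simp)) _ hp).hasFDerivWithinAt) (hs p hp)
  have key := slab_ode ht hU (x := fun p => (posF F t p, velF F t p))
    ((posF_smooth F t).prodMk (velF_smooth F ht)) hXs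
    (fun p hp => by
      have := hD p hp
      rw [slabS] at this
      rw [this]
      refine Prod.ext (velF_eq F ht p hp) ?_
      funext i
      exact (acc_eq F ht p hp i).symm) he (c, 0)
    (by
      have := hD (t, e) ⟨⟨ht.le, le_rfl⟩, he⟩
      rw [slabS] at this
      rw [this]
      exact Prod.ext (pos_end F ht he (c, 0)) hc)
  have h0 := hD (0, e) ⟨⟨le_rfl, ht.le⟩, he⟩
  rw [slabS] at h0
  rw [h0] at key
  have h1 := congrArg Prod.fst key
  exact (pos_start F ht he (c, 0)).symm.trans h1

/-- First variation formula. -/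
theorem first_variation (hB : ∀ i, ContDiff ℝ ∞ (B i)) (hC : ContDiff ℝ ∞ C)
    {t : ℝ} (ht : 0 < t) {e : (Fin n → ℝ) × (Fin n → ℝ)} (he : e ∈ sliceU O t) (m : Fin n) :
    fderiv ℝ (fun q => famS F t e.1 q) e.2 (Pi.single m 1) = velF F t (t, e) m + B m e.2 := by
  have hU := sliceU_open F t
  have hs := slabS_unique F ht
  set g := posF F t with hg
  set v := velF F t with hv
  set s := slabS O t with hsd
  have hgs : ContDiffOn ℝ ∞ g s := posF_smooth F t
  have hvs : ContDiffOn ℝ ∞ v s := velF_smooth F ht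
  set ell : ℝ × (Fin n → ℝ) × (Fin n → ℝ) → ℝ := fun p =>
    (1:ℝ)/2 * ∑ i, v p i ^ 2 + ∑ i, B i (g p) * v p i - C (g p) with hell
  have hvi : ∀ i, ContDiffOn ℝ ∞ (fun p => v p i) s := fun i => contDiffOn_pi.1 hvs i
  have hls : ContDiffOn ℝ ∞ ell s := by
    refine ((contDiffOn_const.mul (ContDiffOn.sum fun i _ => (hvi i).pow 2)).add
      (ContDiffOn.sum fun i _ => ((hB i).comp_contDiffOn hgs).mul (hvi i))).sub
      (hC.comp_contDiffOn hgs)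
  obtain ⟨T, hT, hTw⟩ := slab_integral ht hU hls he
  have hgd : ∀ p ∈ s, HasFDerivWithinAt g (fderivWithin ℝ g s p) s p := fun p hp =>
    ((hgs.differentiableOn (by simp)) _ hp).hasFDerivWithinAt
  have hvd : ∀ p ∈ s, HasFDerivWithinAt v (fderivWithin ℝ v s p) s p := fun p hp =>
    ((hvs.differentiableOn (by simp)) _ hp).hasFDerivWithinAt
  set w : (Fin n → ℝ) × (Fin n → ℝ) := (0, Pi.single m 1) with hw
  have hBd : ∀ i q, HasFDerivAt (B i) (fderiv ℝ (B i) q) q := fun i q =>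
    ((hB i).differentiable (by simp) q).hasFDerivAt
  have hCd : ∀ q, HasFDerivAt C (fderiv ℝ C q) q := fun q =>
    (hC.differentiable (by simp) q).hasFDerivAt
  have hS : fderiv ℝ (fun q => famS F t e.1 q) e.2 (Pi.single m 1) = T w := by
    have h1 : HasFDerivAt (fun x : Fin n → ℝ => (e.1, x)) (ContinuousLinearMap.inr ℝ _ _) e.2 :=
      hasFDerivAt_prodMk_right e.1 e.2
    have h2 : HasFDerivAt (fun q => famS F t e.1 q)
      (T.comp (ContinuousLinearMap.inr ℝ _ _)) e.2 :=
      HasFDerivAt.comp (x := e.2) (f := fun x : Fin n → ℝ => (e.1, x)) hT h1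
    rw [h2.fderiv]
    simp [hw]
  rw [hS]
  have hP := hTw w (fun τ => ∑ i, (v (τ, e) i + B i (g (τ, e))) *
    fderivWithin ℝ g s (τ, e) (0, w) i) ?_
  · rw [hP]
    have h1 : fderivWithin ℝ g s (t, e) (0, w) = w.2 := pos_end F ht he w
    have h0 : fderivWithin ℝ g s (0, e) (0, w) = w.1 := pos_start F ht he w
    have h2 : g (t, e) = e.2 := F.bdry1 (t, e) he
    simp only [h1, h0, h2]
    simp [hw, Pi.single_apply]
  · intro τ hτ
    have hp : (τ, e) ∈ s := ⟨hτ, he⟩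
    set ξ := fderivWithin ℝ g s (τ, e) (0, w) with hξ
    set η := fderivWithin ℝ v s (τ, e) (0, w) with hη
    have hlD : fderivWithin ℝ ell s (τ, e) (0, w) = ∑ i, v (τ, e) i * η i
        + ∑ i, (fderiv ℝ (B i) (g (τ, e)) ξ * v (τ, e) i + B i (g (τ, e)) * η i)
        - fderiv ℝ C (g (τ, e)) ξ := by
      have hvi' : ∀ i, HasFDerivWithinAt (fun p => v p i)
          ((ContinuousLinearMap.proj i).comp (fderivWithin ℝ v s (τ, e))) s (τ, e) :=
        fun i => hasFDerivWithinAt_pi'.1 (hvd _ hp) i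
      have hL := (((HasFDerivWithinAt.fun_sum (u := Finset.univ)
          fun i _ => (hvi' i).pow 2).const_mul ((1:ℝ)/2)).add
        (HasFDerivWithinAt.fun_sum (u := Finset.univ) fun i _ =>
          ((hBd i _).comp_hasFDerivWithinAt (τ, e) (hgd _ hp)).mul (hvi' i))).sub
          ((hCd _).comp_hasFDerivWithinAt (τ, e) (hgd _ hp))
      have hL' : HasFDerivWithinAt ell _ s (τ, e) := hL
      rw [hL'.fderivWithin (hs _ hp)]
      simp [← hξ, ← hη, Finset.mul_sum]
      congr 1
      · refine Finset.sum_congr rfl fun i _ => ?_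
        ring
      · refine Finset.sum_congr rfl fun i _ => ?_
        ring
    change HasDerivWithinAt _ (fderivWithin ℝ ell s (τ, e) (0, w)) _ _
    have hξd : HasDerivWithinAt (fun σ => fderivWithin ℝ g s (σ, e) (0, w)) η (Icc 0 t) τ :=
      slab_symm ht hU hgs hτ he w (velF_eq F ht) (hvd _ hp)
    have hvt := slab_time he (hvd _ hp)
    have hgt := slab_time he (hgd _ hp)
    have hgt1 : fderivWithin ℝ g s (τ, e) (1, 0) = v (τ, e) := (velF_eq F ht _ hp).symm
    rw [hgt1] at hgt
    have hPd := HasDerivWithinAt.fun_sum (u := Finset.univ) fun i _ =>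
      (((hasDerivWithinAt_pi.1 hvt i).add
        ((hBd i _).comp_hasDerivWithinAt τ hgt)).mul (hasDerivWithinAt_pi.1 hξd i))
    refine hPd.congr_deriv ?_
    rw [hlD]
    have hacc : ∀ i, fderivWithin ℝ v s (τ, e) (1, 0) i =
      -(∑ j, (pd (B i) j (g (τ, e)) - pd (B j) i (g (τ, e))) * v (τ, e) j)
        - pd C i (g (τ, e)) := acc_eq F ht _ hp
    simp only [hacc, fderiv_eq_sum_pd, ← hξ]
    have hsw : ∑ i, (∑ j, ξ j * pd (B i) j (g (τ, e))) * v (τ, e) i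
        = ∑ i, (∑ j, pd (B j) i (g (τ, e)) * v (τ, e) j) * ξ i := by
      simp only [Finset.sum_mul]
      rw [Finset.sum_comm]
      exact Finset.sum_congr rfl fun i _ => Finset.sum_congr rfl fun j _ => by ring
    rw [Finset.sum_add_distrib (f := fun i => (∑ j, ξ j * pd (B i) j (g (τ, e))) * v (τ, e) i),
      hsw, ← Finset.sum_add_distrib, ← Finset.sum_add_distrib,
      ← Finset.sum_sub_distrib]
    refine Finset.sum_congr rfl fun i _ => ?_
    have e1 : ∑ j, (pd (B i) j (g (τ, e)) - pd (B j) i (g (τ, e))) * v (τ, e) j =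
        ∑ j, v (τ, e) j * pd (B i) j (g (τ, e)) - ∑ j, pd (B j) i (g (τ, e)) * v (τ, e) j := by
      rw [← Finset.sum_sub_distrib]
      exact Finset.sum_congr rfl fun j _ => by ring
    rw [e1]
    simp only [Function.comp_apply, Pi.add_apply]
    ring

theorem vel_deriv {t : ℝ} (ht : 0 < t) {e : (Fin n → ℝ) × (Fin n → ℝ)} (he : e ∈ sliceU O t)
    (l m : Fin n) :
    fderiv ℝ (fun q => deriv (fun τ => F.f τ t q e.2) t m) e.1 (Pi.single l 1) =
      fderivWithin ℝ (velF F t) (slabS O t) (t, e) (0, (Pi.single l 1, 0)) m := by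
  have hp : (t, e) ∈ slabS O t := ⟨⟨ht.le, le_rfl⟩, he⟩
  have h1 := slab_space (sliceU_open F t) hp.1 he
    (((velF_smooth F ht).differentiableOn (by simp)) _ hp).hasFDerivWithinAt
  have h2 : HasFDerivAt (fun x : Fin n → ℝ => (x, e.2)) (ContinuousLinearMap.inl ℝ _ _) e.1 :=
    hasFDerivAt_prodMk_left e.1 e.2
  have h3 := HasFDerivAt.comp (x := e.1) (f := fun x : Fin n → ℝ => (x, e.2)) h1 h2
  have h4 := hasFDerivAt_pi'.1 h3 m
  have h5 : HasFDerivAt (fun q => deriv (fun τ => F.f τ t q e.2) t m) _ e.1 := h4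
  rw [h5.fderiv]
  simp

end Main

/-- the mixed Hessian of the Hamilton function computes the
`q₀`-derivative of the terminal velocity, and is an invertible matrix. -/
theorem statement11 {n : ℕ} (hn : 1 ≤ n)
    (B : Fin n → (Fin n → ℝ) → ℝ) (C : (Fin n → ℝ) → ℝ)
    (hB : ∀ i, ContDiff ℝ (⊤ : ℕ∞) (B i)) (hC : ContDiff ℝ (⊤ : ℕ∞) C)
    (O : Set (ℝ × (Fin n → ℝ) × (Fin n → ℝ))) (F : SmoothFamily B C O)
    (t : ℝ) (q0 q1 : Fin n → ℝ) (hmem : (t, q0, q1) ∈ O) :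
    (∀ l m : Fin n,
      Hess01 (famS F) t q0 q1 l m
        = fderiv ℝ (fun q => deriv (fun τ => F.f τ t q q1) t m) q0 (Pi.single l 1)) ∧
    IsUnit (Hess01 (famS F) t q0 q1) := by
  have ht : 0 < t := F.pos _ hmem
  have he : (q0, q1) ∈ sliceU O t := hmem
  have hfirst : ∀ l m : Fin n,
      Hess01 (famS F) t q0 q1 l m
        = fderiv ℝ (fun q => deriv (fun τ => F.f τ t q q1) t m) q0 (Pi.single l 1) := by
    intro l m
    have hev : (fun q => fderiv ℝ (fun q1' => famS F t q q1') q1 (Pi.single m 1))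
        =ᶠ[nhds q0] fun q => deriv (fun τ => F.f τ t q q1) t m + B m q1 := by
      have ho : IsOpen {q : Fin n → ℝ | (q, q1) ∈ sliceU O t} :=
        (sliceU_open F t).preimage (by fun_prop)
      exact Filter.eventually_of_mem (ho.mem_nhds he) fun q hq =>
        first_variation F hB hC ht (e := (q, q1)) hq m
    rw [Hess01, Matrix.of_apply, hev.fderiv_eq, fderiv_add_const]
  refine ⟨hfirst, ?_⟩
  rw [← Matrix.vecMul_injective_iff_isUnit]
  change Function.Injective (Hess01 (famS F) t q0 q1).vecMulLinear
  rw [injective_iff_map_eq_zero (Hess01 (famS F) t q0 q1).vecMulLinear]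
  intro c hc
  refine kernel_trivial F hB hC ht he c ?_
  funext m
  have h1 := congrFun hc m
  simp only [Matrix.vecMulLinear_apply, Matrix.vecMul, dotProduct] at h1
  have h2 : ((0:ℝ), (c, (0 : Fin n → ℝ))) =
      ∑ l, c l • ((0:ℝ), ((Pi.single l 1 : Fin n → ℝ), (0 : Fin n → ℝ))) := by
    refine Prod.ext ?_ (Prod.ext ?_ ?_)
    · simp [Prod.fst_sum]
    · funext i
      simp [Prod.snd_sum, Prod.fst_sum, Pi.single_apply]
    · simp [Prod.snd_sum]
  rw [h2, map_sum, Finset.sum_apply]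
  simp only [map_smul, Pi.smul_apply, smul_eq_mul]
  rw [← h1]
  refine Finset.sum_congr rfl fun l _ => ?_
  rw [hfirst, vel_deriv F ht he l m]
end
end
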